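/- There exist η > 0, C > 0 and X₀ > 0 such that the following holds for every integer X ≥ X₀. Let H = ⌊10·X^{1−γ+η}/γ⌋. Then for all reals M, N, V ≥ 1 with X^{7/22} ≤ M ≤ X^{8/22}, X/(2M) ≤ N ≤ 4X/M and V ≤ H, and all complex coefficients a_m (m ∼ M), b_n (n ∼ N) and d_h (h a nonzero integer with |h| ∼ V) of modulus at most 1, one has |T₂*| ≤ C·X^{1−2η}, where T₂* = Σ_{m ∼ M} Σ_{n ∼ N, mn ∼ X} Σ_{|h| ∼ V} a_m·b_n·d_h·e(h·(mn)^γ), the sums running over positive integers m, n and nonzero integers h in the indicated ranges. -/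

import Mathlib

open Finset

noncomputable def e (z : ℝ) : ℂ := Complex.exp (2 * Real.pi * Complex.I * z)

noncomputable def nint (x : ℝ) : ℝ := |x - round x|

noncomputable def dyN (Y : ℝ) : Finset ℕ :=
  (Finset.range (⌈Y⌉₊ + 1)).filter fun m => Y/2 ≤ (m:ℝ) ∧ (m:ℝ) < Y

noncomputable def dyZ (Y : ℝ) : Finset ℤ :=
  (Finset.Icc (-(⌈Y⌉₊:ℤ)) (⌈Y⌉₊:ℤ)).filter fun l => l ≠ 0 ∧ Y/2 ≤ |(l:ℝ)| ∧ |(l:ℝ)| < Y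

lemma norm_e (z : ℝ) : ‖e z‖ = 1 := by
  have : e z = Complex.exp ((2 * Real.pi * z : ℝ) * Complex.I) := by
    unfold e; congr 1; push_cast; ring
  rw [this, Complex.norm_exp_ofReal_mul_I]

lemma e_add (x y : ℝ) : e (x + y) = e x * e y := by
  unfold e; rw [← Complex.exp_add]; congr 1; push_cast; ring

lemma conj_e (x : ℝ) : (starRingEnd ℂ) (e x) = e (-x) := by
  unfold e
  rw [← Complex.exp_conj]; congr 1
  simp [Complex.conj_ofNat]

lemma e_sub_intCast (x : ℝ) (k : ℤ) : e (x - k) = e x := by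
  unfold e
  rw [Complex.exp_eq_exp_iff_exists_int]
  exact ⟨-k, by push_cast; ring⟩

/-- The cotangent form of `1 / (1 - e θ)`. -/
lemma one_sub_e_mul_cot {θ : ℝ} (hs : Real.sin (Real.pi * θ) ≠ 0) :
    (1 - e θ) * (1 / 2 + Complex.I / 2 * (Real.cot (Real.pi * θ) : ℝ)) = 1 := by
  have he : e θ = (Real.cos (Real.pi * θ) + Real.sin (Real.pi * θ) * Complex.I) ^ 2 := by
    have : e θ = Complex.exp ((Real.pi * θ : ℝ) * Complex.I) ^ 2 := by
      unfold e; rw [← Complex.exp_nat_mul]; congr 1; push_cast; ring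
    rw [this, Complex.exp_mul_I, Complex.ofReal_cos, Complex.ofReal_sin]
  rw [he, Real.cot_eq_cos_div_sin]
  have h1 := Real.sin_sq_add_cos_sq (Real.pi * θ)
  have h2 : ((Real.sin (Real.pi * θ) : ℝ) : ℂ) ≠ 0 := by exact_mod_cast hs
  have h3 : ((Real.sin (Real.pi * θ) : ℝ) : ℂ) ^ 2 + ((Real.cos (Real.pi * θ) : ℝ) : ℂ) ^ 2 = 1 := by
    exact_mod_cast h1
  set s : ℂ := ((Real.sin (Real.pi * θ) : ℝ) : ℂ)
  set c : ℂ := ((Real.cos (Real.pi * θ) : ℝ) : ℂ)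
  have hI : Complex.I ^ 2 = -1 := Complex.I_sq
  have key : (1 - (c + s * Complex.I) ^ 2) * (s + Complex.I * c) = 2 * s := by
    linear_combination (-(c + s * Complex.I) * Complex.I) * h3
      + (-s + (c + s * Complex.I) * Complex.I * s ^ 2 - s * (c + s * Complex.I) ^ 2) * hI
  have h4 : 1 / 2 + Complex.I / 2 * (c / s) = (s + Complex.I * c) / (2 * s) := by
    field_simp
  rw [Complex.ofReal_div, h4, ← mul_div_assoc, key, div_self (mul_ne_zero two_ne_zero h2)]

lemma two_mul_le_sin_pi_mul {θ ε : ℝ} (hε : 0 < ε) (h1 : ε ≤ θ) (h2 : θ ≤ 1 - ε) :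
    2 * ε ≤ Real.sin (Real.pi * θ) := by
  have hpi := Real.pi_pos
  rcases le_total θ (1 / 2) with h | h
  · have := Real.mul_le_sin (x := Real.pi * θ) (mul_nonneg hpi.le (hε.le.trans h1)) (by nlinarith)
    have h3 : 2 / Real.pi * (Real.pi * θ) = 2 * θ := by field_simp
    linarith
  · have := Real.mul_le_sin (x := Real.pi * (1 - θ)) (by nlinarith) (by nlinarith)
    have h3 : 2 / Real.pi * (Real.pi * (1 - θ)) = 2 * (1 - θ) := by field_simp
    have h4 : Real.sin (Real.pi * (1 - θ)) = Real.sin (Real.pi * θ) := by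
      rw [mul_sub, mul_one, Real.sin_pi_sub]
    linarith

lemma cot_pi_mul_antitone {θ φ : ℝ} (h0 : 0 < θ) (h : θ ≤ φ) (h1 : φ < 1) :
    Real.cot (Real.pi * φ) ≤ Real.cot (Real.pi * θ) := by
  have hpi := Real.pi_pos
  have s1 : 0 < Real.sin (Real.pi * θ) :=
    Real.sin_pos_of_pos_of_lt_pi (by positivity) (by nlinarith)
  have s2 : 0 < Real.sin (Real.pi * φ) :=
    Real.sin_pos_of_pos_of_lt_pi (mul_pos hpi (h0.trans_le h)) (by nlinarith)
  rw [Real.cot_eq_cos_div_sin, Real.cot_eq_cos_div_sin, div_le_div_iff₀ s2 s1]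
  have : 0 ≤ Real.sin (Real.pi * φ - Real.pi * θ) :=
    Real.sin_nonneg_of_nonneg_of_le_pi (by nlinarith) (by nlinarith)
  rw [Real.sin_sub] at this
  linarith

lemma abs_cot_pi_mul_le {θ ε : ℝ} (hε : 0 < ε) (h1 : ε ≤ θ) (h2 : θ ≤ 1 - ε) :
    |Real.cot (Real.pi * θ)| ≤ 1 / (2 * ε) := by
  have hs := two_mul_le_sin_pi_mul hε h1 h2
  rw [Real.cot_eq_cos_div_sin, abs_div, abs_of_pos (by linarith : 0 < Real.sin (Real.pi * θ))]
  exact div_le_div₀ zero_le_one (Real.abs_cos_le_one _) (by positivity) hs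

/-- A discrete form of the Kusmin-Landau inequality. -/
lemma kusmin_landau (x : ℕ → ℝ) (u v : ℕ) (k : ℤ) {ε : ℝ} (hε : 0 < ε)
    (hmono : ∀ n, u ≤ n → n + 1 < v → x (n + 1) - x n ≤ x (n + 2) - x (n + 1))
    (hlo : ∀ n, u ≤ n → n < v → k + ε ≤ x (n + 1) - x n)
    (hhi : ∀ n, u ≤ n → n < v → x (n + 1) - x n ≤ k + 1 - ε) :
    ‖∑ n ∈ Ico u v, e (x n)‖ ≤ 2 / ε := by
  rcases le_or_gt v u with huv | huv
  · rw [Ico_eq_empty (by omega)]; simp; positivity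
  set ct : ℕ → ℝ := fun n => Real.cot (Real.pi * (x (n + 1) - x n - k)) with hct
  set g : ℕ → ℂ := fun n => 1 / 2 + Complex.I / 2 * (ct n : ℝ) with hg
  have hctb : ∀ n, u ≤ n → n < v → |ct n| ≤ 1 / (2 * ε) := fun n h1 h2 =>
    abs_cot_pi_mul_le hε (by linarith [hlo n h1 h2]) (by linarith [hhi n h1 h2])
  have hε2 : ε ≤ 1 / 2 := by linarith [hlo u le_rfl huv, hhi u le_rfl huv]
  have hgb : ∀ n, u ≤ n → n < v → ‖g n‖ ≤ 1 / 2 + 1 / (4 * ε) := fun n h1 h2 => by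
    have := hctb n h1 h2
    calc ‖g n‖ ≤ ‖(1 / 2 : ℂ)‖ + ‖Complex.I / 2 * (ct n : ℝ)‖ := norm_add_le _ _
      _ = 1 / 2 + 1 / 2 * |ct n| := by simp
      _ ≤ 1 / 2 + 1 / 2 * (1 / (2 * ε)) := by gcongr
      _ = _ := by field_simp; ring
  have hz : ∀ n, u ≤ n → n < v → e (x n) + g n * e (x (n + 1)) = g n * e (x n)  := by
    intro n h1 h2
    have hs := two_mul_le_sin_pi_mul (θ := x (n + 1) - x n - k) hε
      (by linarith [hlo n h1 h2]) (by linarith [hhi n h1 h2])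
    have h := one_sub_e_mul_cot (θ := x (n + 1) - x n - k) (by linarith)
    rw [e_sub_intCast] at h
    have h' : e (x (n + 1)) = e (x (n + 1) - x n) * e (x n) := by rw [← e_add]; congr 1; ring
    rw [h']
    simp only [hg, hct]
    linear_combination (-e (x n)) * h
  have key : ∀ j, u + 1 + j ≤ v → ‖∑ n ∈ Ico u (u + 1 + j), e (x n) + g (u + j) * e (x (u + j + 1))‖
      ≤ ‖g u‖ + 1 / 2 * (ct u - ct (u + j)) := by
    intro j
    induction j with
    | zero =>
      intro h
      simp only [add_zero, Nat.Ico_succ_singleton, sum_singleton]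
      rw [hz u le_rfl huv, norm_mul, norm_e]; simp
    | succ j ih =>
      intro h
      have ih := ih (by omega)
      have e1 : ∑ n ∈ Ico u (u + 1 + (j + 1)), e (x n) + g (u + (j + 1)) * e (x (u + (j + 1) + 1))
          = (∑ n ∈ Ico u (u + 1 + j), e (x n) + g (u + j) * e (x (u + j + 1)))
            + (g (u + (j + 1)) - g (u + j)) * e (x (u + j + 1)) := by
        rw [show u + 1 + (j + 1) = (u + 1 + j) + 1 by ring, sum_Ico_succ_top (by omega)]
        have := hz (u + (j + 1)) (by omega) (by omega)
        rw [show u + 1 + j = u + (j + 1) by ring, show u + j + 1 = u + (j + 1) by ring]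
        linear_combination this
      rw [e1]
      refine (norm_add_le _ _).trans ?_
      rw [norm_mul, norm_e, mul_one]
      have hm : ct (u + (j + 1)) ≤ ct (u + j) := by
        apply cot_pi_mul_antitone
        · linarith [hlo (u + j) (by omega) (by omega)]
        · have := hmono (u + j) (by omega) (by omega)
          rw [show u + (j + 1) + 1 = u + j + 2 by ring, show u + (j + 1) = u + j + 1 by ring]
          linarith
        · have := hhi (u + (j + 1)) (by omega) (by omega)
          linarith
      have e2 : ‖g (u + (j + 1)) - g (u + j)‖ = 1 / 2 * (ct (u + j) - ct (u + (j + 1))) := by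
        have : g (u + (j + 1)) - g (u + j)
          = Complex.I / 2 * ((ct (u + (j + 1)) - ct (u + j) : ℝ) : ℂ) := by
          simp only [hg]; push_cast; ring
        rw [this, norm_mul, Complex.norm_real, Real.norm_eq_abs, abs_of_nonpos (by linarith)]
        simp
      rw [e2]; linarith
  have hk := key (v - (u + 1)) (by omega)
  rw [show u + 1 + (v - (u + 1)) = v by omega] at hk
  set w := u + (v - (u + 1)) with hw
  have hw1 : u ≤ w := by omega
  have hw2 : w < v := by omega
  have h1 : ‖∑ n ∈ Ico u v, e (x n)‖ ≤
      ‖∑ n ∈ Ico u v, e (x n) + g w * e (x (w + 1))‖ + ‖g w‖ := by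
    have := norm_sub_le (∑ n ∈ Ico u v, e (x n) + g w * e (x (w + 1))) (g w * e (x (w + 1)))
    rwa [add_sub_cancel_right, norm_mul, norm_e, mul_one] at this
  have h2 := hgb u le_rfl huv
  have h3 := hgb w hw1 hw2
  have h4 := abs_le.1 (hctb u le_rfl huv)
  have h5 := abs_le.1 (hctb w hw1 hw2)
  have h6 : 1 ≤ 1 / (2 * ε) := by rw [le_div_iff₀ (by positivity)]; linarith
  have h7 : 1 / (4 * ε) = 1 / (2 * ε) / 2 := by field_simp; ring
  have h8 : 2 / ε = 4 * (1 / (2 * ε)) := by field_simp; ring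
  rw [h8]; linarith

lemma exists_eq_Ico_of_convex (s : Finset ℕ)
    (hs : ∀ a ∈ s, ∀ b ∈ s, ∀ n, a ≤ n → n ≤ b → n ∈ s) : ∃ u v, s = Ico u v := by
  rcases s.eq_empty_or_nonempty with rfl | hne
  · exact ⟨0, 0, by simp⟩
  · refine ⟨s.min' hne, s.max' hne + 1, ?_⟩
    ext n
    rw [mem_Ico]
    constructor
    · intro h
      exact ⟨s.min'_le n h, Nat.lt_succ_of_le (s.le_max' n h)⟩
    · rintro ⟨h1, h2⟩
      exact hs _ (s.min'_mem hne) _ (s.max'_mem hne) n h1 (Nat.le_of_lt_succ h2)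

lemma card_le_of_diameter_le (s : Finset ℕ) {L : ℝ} (hL : 0 ≤ L)
    (hs : ∀ a ∈ s, ∀ b ∈ s, a ≤ b → (b : ℝ) - a ≤ L) : (s.card : ℝ) ≤ L + 1 := by
  rcases s.eq_empty_or_nonempty with rfl | hne
  · simp; linarith
  · have h1 : s ⊆ Icc (s.min' hne) (s.max' hne) := fun n hn =>
      mem_Icc.2 ⟨s.min'_le n hn, s.le_max' n hn⟩
    have h2 := card_le_card h1
    rw [Nat.card_Icc] at h2
    have hle : s.min' hne ≤ s.max' hne := s.min'_le _ (s.max'_mem hne)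
    have h3 := hs _ (s.min'_mem hne) _ (s.max'_mem hne) hle
    have h4 : (s.card : ℝ) ≤ ((s.max' hne + 1 - s.min' hne : ℕ) : ℝ) := by exact_mod_cast h2
    rw [Nat.cast_sub (by omega)] at h4
    push_cast at h4
    linarith

/-- A discrete form of van der Corput's second derivative test. -/
lemma second_difference_test (x : ℕ → ℝ) (u v : ℕ) (huv : u ≤ v) {l α : ℝ} (hl : 0 < l)
    (hα : 1 ≤ α)
    (hlo : ∀ n, u ≤ n → n < v → l ≤ (x (n + 2) - x (n + 1)) - (x (n + 1) - x n))
    (hhi : ∀ n, u ≤ n → n < v → (x (n + 2) - x (n + 1)) - (x (n + 1) - x n) ≤ α * l) :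
    ‖∑ n ∈ Ico u v, e (x n)‖ ≤ 5 * α * (v - u) * √l + 10 / √l := by
  have hsl : 0 < √l := Real.sqrt_pos.2 hl
  have hss : √l * √l = l := Real.mul_self_sqrt hl.le
  have huv' : (u : ℝ) ≤ v := by exact_mod_cast huv
  have hK : (0 : ℝ) ≤ v - u := by linarith
  rcases lt_or_ge (1 / 4) l with hl4 | hl4
  · have h1 : 1 / 2 ≤ √l := by
      apply Real.le_sqrt_of_sq_le; linarith
    have h2 : ‖∑ n ∈ Ico u v, e (x n)‖ ≤ v - u := by
      refine (norm_sum_le _ _).trans ?_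
      simp only [norm_e, sum_const, Nat.card_Ico, nsmul_eq_mul, mul_one]
      rw [Nat.cast_sub huv]
    have h3 : (v - u : ℝ) * 1 ≤ (v - u) * (5 * α * √l) := by
      apply mul_le_mul_of_nonneg_left _ hK
      nlinarith
    have h4 : 0 < 10 / √l := by positivity
    nlinarith
  set θ : ℕ → ℝ := fun n => x (n + 1) - x n with hθ
  have hstep : ∀ j n, u ≤ n → n + j ≤ v → l * j ≤ θ (n + j) - θ n ∧ θ (n + j) - θ n ≤ α * l * j := by
    intro j
    induction j with
    | zero => intro n _ _; simp
    | succ j ih =>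
      intro n h1 h2
      obtain ⟨i1, i2⟩ := ih n h1 (by omega)
      have a1 := hlo (n + j) (by omega) (by omega)
      have a2 := hhi (n + j) (by omega) (by omega)
      have e1 : θ (n + (j + 1)) = x (n + j + 2) - x (n + j + 1) := rfl
      have e2 : θ (n + j) = x (n + j + 1) - x (n + j) := rfl
      rw [← e1, ← e2] at a1 a2
      push_cast
      constructor <;> linarith
  have hsep : ∀ n m, u ≤ n → n ≤ m → m ≤ v → l * ((m : ℝ) - n) ≤ θ m - θ n := by
    intro n m h1 h2 h3
    have := (hstep (m - n) n h1 (by omega)).1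
    rwa [show n + (m - n) = m by omega, Nat.cast_sub h2] at this
  have hmono : ∀ n m, u ≤ n → n ≤ m → m ≤ v → θ n ≤ θ m := by
    intro n m h1 h2 h3
    have := hsep n m h1 h2 h3
    have h4 : (n : ℝ) ≤ m := by exact_mod_cast h2
    nlinarith
  have htot : θ v - θ u ≤ α * l * (v - u) := by
    have := (hstep (v - u) u le_rfl (by omega)).2
    rwa [show u + (v - u) = v by omega, Nat.cast_sub huv] at this
  have hmaps : ∀ n ∈ Ico u v, ⌊θ n⌋ ∈ Icc ⌊θ u⌋ ⌊θ v⌋ := by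
    intro n hn
    rw [mem_Ico] at hn
    exact mem_Icc.2 ⟨Int.floor_le_floor (hmono u n le_rfl hn.1 hn.2.le),
      Int.floor_le_floor (hmono n v hn.1 hn.2.le le_rfl)⟩
  rw [← sum_fiberwise_of_maps_to hmaps]
  have hbad : ∀ s ⊆ Ico u v, (∀ a ∈ s, ∀ b ∈ s, θ b - θ a ≤ √l) →
      ‖∑ n ∈ s, e (x n)‖ ≤ 1 / √l + 1 := by
    intro s hs h
    have h1 : ‖∑ n ∈ s, e (x n)‖ ≤ s.card := by
      refine (norm_sum_le _ _).trans ?_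
      simp [norm_e]
    refine h1.trans (card_le_of_diameter_le s (by positivity) ?_)
    intro a ha b hb hab
    have ha' := mem_Ico.1 (hs ha)
    have hb' := mem_Ico.1 (hs hb)
    have h2 := hsep a b ha'.1 hab hb'.2.le
    have h3 := h a ha b hb
    rw [le_div_iff₀ hsl]
    have : √l * ((b - a) * √l) ≤ √l * 1 := by
      calc √l * ((b - a) * √l) = l * (b - a) := by linear_combination ((b : ℝ) - a) * hss
        _ ≤ √l * 1 := by linarith
    exact le_of_mul_le_mul_left this hsl
  have hin : ∀ k ∈ Icc ⌊θ u⌋ ⌊θ v⌋, ‖∑ n ∈ Ico u v with ⌊θ n⌋ = k, e (x n)‖ ≤ 5 / √l := by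
    intro k _
    set s := (Ico u v).filter fun n => ⌊θ n⌋ = k with hsdef
    have hs : ∀ n ∈ s, u ≤ n ∧ n < v ∧ (k : ℝ) ≤ θ n ∧ θ n < k + 1 := by
      intro n hn
      rw [hsdef, mem_filter, mem_Ico, Int.floor_eq_iff] at hn
      exact ⟨hn.1.1, hn.1.2, hn.2⟩
    have hs' : ∀ n, u ≤ n → n < v → (k : ℝ) ≤ θ n → θ n < k + 1 → n ∈ s := by
      intro n h1 h2 h3 h4
      rw [hsdef, mem_filter, mem_Ico, Int.floor_eq_iff]
      exact ⟨⟨h1, h2⟩, h3, h4⟩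
    have hsub : s ⊆ Ico u v := filter_subset _ _
    rw [← sum_filter_add_sum_filter_not s (fun n => θ n < k + √l),
      ← sum_filter_add_sum_filter_not (s.filter fun n => ¬ θ n < k + √l)
        (fun n => k + 1 - √l < θ n)]
    have b1 : ‖∑ n ∈ s with θ n < k + √l, e (x n)‖ ≤ 1 / √l + 1 := by
      apply hbad _ ((filter_subset _ _).trans hsub)
      intro a ha b hb
      have h1 := (hs a (mem_filter.1 ha).1).2.2.1
      have h2 := (mem_filter.1 hb).2
      linarith
    have b2 : ‖∑ n ∈ s.filter (fun n => ¬ θ n < k + √l) with k + 1 - √l < θ n, e (x n)‖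
        ≤ 1 / √l + 1 := by
      apply hbad _ ((filter_subset _ _).trans ((filter_subset _ _).trans hsub))
      intro a ha b hb
      have h1 := (mem_filter.1 ha).2
      have h2 := (hs b (mem_filter.1 (mem_filter.1 hb).1).1).2.2.2
      linarith
    have b3 : ‖∑ n ∈ s.filter (fun n => ¬ θ n < k + √l) with ¬ (k + 1 - √l < θ n), e (x n)‖
        ≤ 2 / √l := by
      set t := (s.filter (fun n => ¬ θ n < k + √l)).filter (fun n => ¬ (k + 1 - √l < θ n)) with ht
      have ht1 : ∀ n ∈ t, u ≤ n ∧ n < v ∧ (k : ℝ) + √l ≤ θ n ∧ θ n ≤ k + 1 - √l := by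
        intro n hn
        rw [ht, mem_filter, mem_filter] at hn
        have := hs n hn.1.1
        exact ⟨this.1, this.2.1, not_lt.1 hn.1.2, not_lt.1 hn.2⟩
      have ht2 : ∀ n, u ≤ n → n < v → (k : ℝ) + √l ≤ θ n → θ n ≤ k + 1 - √l → n ∈ t := by
        intro n h1 h2 h3 h4
        rw [ht, mem_filter, mem_filter]
        exact ⟨⟨hs' n h1 h2 (by linarith) (by linarith), not_lt.2 h3⟩, not_lt.2 h4⟩
      obtain ⟨u', v', htI⟩ := exists_eq_Ico_of_convex t (by
        intro a ha b hb n h1 h2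
        have ha := ht1 a ha
        have hb := ht1 b hb
        have m1 := hmono a n ha.1 h1 (by omega)
        have m2 := hmono n b (by omega) h2 hb.2.1.le
        exact ht2 n (by omega) (by omega) (by linarith) (by linarith))
      rw [htI] at ht1 ⊢
      refine kusmin_landau x u' v' k hsl ?_ ?_ ?_
      · intro n h1 h2
        have := ht1 n (mem_Ico.2 ⟨h1, by omega⟩)
        exact hmono n (n + 1) this.1 (by omega) (by omega)
      · intro n h1 h2
        exact (ht1 n (mem_Ico.2 ⟨h1, by omega⟩)).2.2.1
      · intro n h1 h2
        exact (ht1 n (mem_Ico.2 ⟨h1, by omega⟩)).2.2.2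
    have h2 : √l ≤ 1 / 2 := by
      rw [Real.sqrt_le_left (by norm_num)]; linarith
    have h3 : 2 ≤ 1 / √l := by rw [le_div_iff₀ hsl]; linarith
    have h4 : 5 / √l = 5 * (1 / √l) := by ring
    have h5 : 2 / √l = 2 * (1 / √l) := by ring
    refine (norm_add_le _ _).trans ?_
    have := norm_add_le (∑ n ∈ s.filter (fun n => ¬ θ n < k + √l) with k + 1 - √l < θ n, e (x n))
      (∑ n ∈ s.filter (fun n => ¬ θ n < k + √l) with ¬ (k + 1 - √l < θ n), e (x n))
    linarith
  refine (norm_sum_le_of_le _ hin).trans ?_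
  rw [sum_const, Int.card_Icc, nsmul_eq_mul]
  have hfl : ⌊θ u⌋ ≤ ⌊θ v⌋ := Int.floor_le_floor (hmono u v le_rfl huv le_rfl)
  have hcard : (((⌊θ v⌋ + 1 - ⌊θ u⌋).toNat : ℕ) : ℝ) ≤ α * l * (v - u) + 2 := by
    have h1 : (((⌊θ v⌋ + 1 - ⌊θ u⌋).toNat : ℤ) : ℝ) = ((⌊θ v⌋ + 1 - ⌊θ u⌋ : ℤ) : ℝ) := by
      rw [Int.toNat_of_nonneg (by omega)]
    rw [Int.cast_natCast] at h1
    rw [h1]; push_cast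
    have := Int.floor_le (θ v)
    have := Int.lt_floor_add_one (θ u)
    linarith
  calc _ ≤ (α * l * (v - u) + 2) * (5 / √l) := by gcongr
    _ = _ := by
      field_simp
      rw [Real.sq_sqrt hl.le]; ring

lemma second_difference_rpow {γ y : ℝ} (hy : 0 < y) :
    ∃ ξ, y < ξ ∧ ξ < y + 2 ∧
      ((y + 2) ^ γ - (y + 1) ^ γ) - ((y + 1) ^ γ - y ^ γ) = γ * (γ - 1) * ξ ^ (γ - 2) := by
  have hd : ∀ p z : ℝ, 0 < z → HasDerivAt (fun t : ℝ => t ^ p) (p * z ^ (p - 1)) z := fun p z hz =>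
    Real.hasDerivAt_rpow_const (Or.inl hz.ne')
  have hd1 : ∀ p z : ℝ, 0 < z →
      HasDerivAt (fun t : ℝ => (t + 1) ^ p) (p * (z + 1) ^ (p - 1)) z := fun p z hz => by
    have := (hd p (z + 1) (by linarith)).comp_add_const z 1
    simpa using this
  obtain ⟨ξ₁, h1, e1⟩ := exists_hasDerivAt_eq_slope (fun t : ℝ => (t + 1) ^ γ - t ^ γ)
    (fun t => γ * (t + 1) ^ (γ - 1) - γ * t ^ (γ - 1)) (lt_add_one y)
    (fun t ht => (((hd1 γ t (hy.trans_le ht.1)).sub (hd γ t (hy.trans_le ht.1)))).continuousAt.continuousWithinAt)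
    (fun t ht => (hd1 γ t (hy.trans ht.1)).sub (hd γ t (hy.trans ht.1)))
  have hξ₁ : 0 < ξ₁ := hy.trans h1.1
  obtain ⟨ξ₂, h2, e2⟩ := exists_hasDerivAt_eq_slope (fun t : ℝ => γ * t ^ (γ - 1))
    (fun t => γ * ((γ - 1) * t ^ (γ - 1 - 1))) (lt_add_one ξ₁)
    (fun t ht => ((hd (γ - 1) t (hξ₁.trans_le ht.1)).const_mul γ).continuousAt.continuousWithinAt)
    (fun t ht => (hd (γ - 1) t (hξ₁.trans ht.1)).const_mul γ)
  refine ⟨ξ₂, h1.1.trans h2.1, by linarith [h2.2, h1.2], ?_⟩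
  simp only [add_sub_cancel_left, div_one] at e1 e2
  rw [show y + 1 + 1 = y + 2 by ring] at e1
  rw [← e1, ← e2, show γ - 1 - 1 = γ - 2 by ring]
  ring

lemma rpow_sub_two_bounds {γ N ξ : ℝ} (h0 : 0 < γ) (h1 : γ < 1) (hN : 0 < N) (hlo : N / 2 ≤ ξ)
    (hhi : ξ ≤ 3 * N) : N ^ (γ - 2) / 9 ≤ ξ ^ (γ - 2) ∧ ξ ^ (γ - 2) ≤ 4 * N ^ (γ - 2) := by
  have hξ : 0 < ξ := by linarith
  have hp : 0 < N ^ (γ - 2) := by positivity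
  constructor
  · have a1 : (3 * N) ^ (γ - 2) ≤ ξ ^ (γ - 2) :=
      Real.rpow_le_rpow_of_nonpos hξ hhi (by linarith)
    rw [Real.mul_rpow (by norm_num) hN.le] at a1
    have a2 : (3 : ℝ) ^ (-2 : ℝ) ≤ 3 ^ (γ - 2) :=
      Real.rpow_le_rpow_of_exponent_le (by norm_num) (by linarith)
    have a3 : (3 : ℝ) ^ (-2 : ℝ) = 1 / 9 := by
      rw [Real.rpow_neg (by norm_num)]; norm_num
    rw [a3] at a2
    nlinarith
  · have a1 : ξ ^ (γ - 2) ≤ (2⁻¹ * N) ^ (γ - 2) :=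
      Real.rpow_le_rpow_of_nonpos (by positivity) (by linarith) (by linarith)
    rw [Real.mul_rpow (by norm_num) hN.le, Real.inv_rpow (by norm_num),
      ← Real.rpow_neg (by norm_num)] at a1
    have a2 : (2 : ℝ) ^ (-(γ - 2)) ≤ 2 ^ (2 : ℝ) :=
      Real.rpow_le_rpow_of_exponent_le (by norm_num) (by linarith)
    have a3 : (2 : ℝ) ^ (2 : ℝ) = 4 := by norm_num
    rw [a3] at a2
    nlinarith

lemma norm_sum_e_neg (s : Finset ℕ) (f : ℕ → ℝ) :
    ‖∑ n ∈ s, e (-f n)‖ = ‖∑ n ∈ s, e (f n)‖ := by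
  rw [← Complex.norm_conj (∑ n ∈ s, e (f n)), map_sum]
  simp only [conj_e]

lemma norm_sum_e_mul_rpow_le {γ : ℝ} (h0 : 0 < γ) (h1 : γ < 1) :
    ∃ C > (0 : ℝ), ∀ N : ℝ, 1 ≤ N → ∀ u v : ℕ, (∀ n ∈ Ico u v, N / 2 ≤ (n : ℝ) ∧ (n : ℝ) < N) →
      ∀ Δ : ℝ, Δ ≠ 0 →
      ‖∑ n ∈ Ico u v, e (Δ * (n : ℝ) ^ γ)‖ ≤
        C * (√(|Δ| * N ^ γ) + N / √(|Δ| * N ^ γ)) := by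
  set κ : ℝ := γ * (1 - γ) with hκ
  have hκ0 : 0 < κ := mul_pos h0 (by linarith)
  set s : ℝ := √(κ / 9) with hs
  have hs0 : 0 < s := Real.sqrt_pos.2 (by positivity)
  refine ⟨360 * s + 10 / s, by positivity, ?_⟩
  intro N hN u v hI Δ hΔ
  have hN0 : 0 < N := by linarith
  set D : ℝ := |Δ| * N ^ γ with hD
  have hD0 : 0 < D := mul_pos (abs_pos.2 hΔ) (by positivity)
  have hsD : 0 < √D := Real.sqrt_pos.2 hD0
  rcases le_or_gt v u with huv | huv
  · rw [Ico_eq_empty (by omega)]; simp; positivity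
  have main : ‖∑ n ∈ Ico u v, e (-(|Δ| * (n : ℝ) ^ γ))‖ ≤
      (360 * s + 10 / s) * (√D + N / √D) := by
    set l : ℝ := |Δ| * κ * N ^ (γ - 2) / 9 with hl
    have hΔ0 : 0 < |Δ| := abs_pos.2 hΔ
    have hl0 : 0 < l := by positivity
    have hl2 : l = (s * √D / N) ^ 2 := by
      rw [div_pow, mul_pow, Real.sq_sqrt hD0.le, hs, Real.sq_sqrt (by positivity), hl, hD,
        Real.rpow_sub hN0, Real.rpow_two]
      ring
    have hsl : √l = s * √D / N := by
      rw [hl2, Real.sqrt_sq (by positivity)]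
    have hdiff : ∀ n : ℕ, u ≤ n → n < v → ∃ ξ, N ^ (γ - 2) / 9 ≤ ξ ∧ ξ ≤ 4 * N ^ (γ - 2) ∧
        (-(|Δ| * ((n + 2 : ℕ) : ℝ) ^ γ) - -(|Δ| * ((n + 1 : ℕ) : ℝ) ^ γ))
          - (-(|Δ| * ((n + 1 : ℕ) : ℝ) ^ γ) - -(|Δ| * (n : ℝ) ^ γ)) = |Δ| * κ * ξ := by
      intro n hn1 hn2
      have hn := hI n (mem_Ico.2 ⟨hn1, hn2⟩)
      obtain ⟨ξ, k1, k2, k3⟩ := second_difference_rpow (γ := γ) (y := n) (by linarith)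
      obtain ⟨k4, k5⟩ := rpow_sub_two_bounds (ξ := ξ) h0 h1 hN0 (by linarith) (by linarith)
      refine ⟨ξ ^ (γ - 2), k4, k5, ?_⟩
      push_cast
      rw [hκ]
      linear_combination (-|Δ|) * k3
    have h := second_difference_test (fun n => -(|Δ| * (n : ℝ) ^ γ)) u v huv.le (α := 36) hl0
      (by norm_num)
      (fun n hn1 hn2 => by
        obtain ⟨ξ, k1, k2, k3⟩ := hdiff n hn1 hn2
        simp only [k3]
        rw [hl]
        calc _ = |Δ| * κ * (N ^ (γ - 2) / 9) := by ring
          _ ≤ _ := by gcongr)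
      (fun n hn1 hn2 => by
        obtain ⟨ξ, k1, k2, k3⟩ := hdiff n hn1 hn2
        simp only [k3]
        rw [hl]
        calc _ ≤ |Δ| * κ * (4 * N ^ (γ - 2)) := by gcongr
          _ = _ := by ring)
    have hlen : (v : ℝ) - u ≤ 2 * N := by
      have b1 := (hI u (mem_Ico.2 ⟨le_rfl, huv⟩)).1
      have b2 := (hI (v - 1) (mem_Ico.2 ⟨by omega, by omega⟩)).2
      rw [Nat.cast_sub (by omega)] at b2
      push_cast at b2
      linarith
    refine h.trans ?_
    rw [hsl]
    have c1 : 5 * 36 * ((v : ℝ) - u) * (s * √D / N) ≤ 5 * 36 * (2 * N) * (s * √D / N) := by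
      gcongr
    have c2 : 5 * 36 * (2 * N) * (s * √D / N) = 360 * s * √D := by
      field_simp; ring
    have c3 : 10 / (s * √D / N) = 10 / s * (N / √D) := by
      field_simp
    have c4 : 0 < 10 / s * √D := by positivity
    have c5 : 0 < 360 * s * (N / √D) := by positivity
    rw [c3]
    linarith
  rcases lt_or_gt_of_ne hΔ with h | h
  · rw [abs_of_neg h] at main
    simpa using main
  · rw [abs_of_pos h, norm_sum_e_neg] at main
    exact main

lemma card_coprime_near_le (s : Finset (ℕ × ℕ)) {A δ x : ℝ} (hδ : 0 ≤ δ)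
    (h1 : ∀ p ∈ s, 1 ≤ p.2) (h2 : ∀ p ∈ s, (p.2 : ℝ) ≤ A) (h3 : ∀ p ∈ s, p.1.Coprime p.2)
    (h4 : ∀ p ∈ s, |(p.1 : ℝ) / p.2 - x| ≤ δ) : (s.card : ℝ) ≤ 1 + 2 * δ * A ^ 2 := by
  have key : s.card ≤ (range (⌊2 * δ * A ^ 2⌋₊ + 1)).card := by
    apply card_le_card_of_injOn (fun p => ⌊((p.1 : ℝ) / p.2 - x + δ) * A ^ 2⌋₊)
    · intro p hp
      have := abs_le.1 (h4 p hp)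
      simp only [coe_range, Set.mem_Iio]
      apply Nat.lt_succ_of_le
      apply Nat.floor_le_floor
      apply mul_le_mul_of_nonneg_right _ (sq_nonneg A)
      linarith
    · intro p hp q hq hpq
      have hp := mem_coe.1 hp
      have hq := mem_coe.1 hq
      have a1 := abs_le.1 (h4 p hp)
      have a2 := abs_le.1 (h4 q hq)
      have np : 0 ≤ ((p.1 : ℝ) / p.2 - x + δ) * A ^ 2 :=
        mul_nonneg (by linarith) (sq_nonneg A)
      have nq : 0 ≤ ((q.1 : ℝ) / q.2 - x + δ) * A ^ 2 :=
        mul_nonneg (by linarith) (sq_nonneg A)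
      simp only at hpq
      have f1 := Nat.floor_le np
      have f2 := Nat.lt_floor_add_one (((p.1 : ℝ) / p.2 - x + δ) * A ^ 2)
      have f3 := Nat.floor_le nq
      have f4 := Nat.lt_floor_add_one (((q.1 : ℝ) / q.2 - x + δ) * A ^ 2)
      rw [hpq] at f1 f2
      have hp2 : (1 : ℝ) ≤ p.2 := by exact_mod_cast h1 p hp
      have hq2 : (1 : ℝ) ≤ q.2 := by exact_mod_cast h1 q hq
      have hlt : |((p.1 : ℝ) / p.2 - q.1 / q.2) * A ^ 2| < 1 := by
        rw [abs_lt]; constructor <;> linarith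
      have hA : (p.2 : ℝ) * q.2 ≤ A ^ 2 := by
        rw [sq]
        exact mul_le_mul (h2 p hp) (h2 q hq) (by positivity) (by linarith [h2 p hp])
      have hcross : |(p.1 : ℝ) * q.2 - q.1 * p.2| < 1 := by
        have e1 : (p.1 : ℝ) * q.2 - q.1 * p.2 = ((p.1 : ℝ) / p.2 - q.1 / q.2) * (p.2 * q.2) := by
          have : (p.2 : ℝ) ≠ 0 := by positivity
          have : (q.2 : ℝ) ≠ 0 := by positivity
          field_simp
        rw [e1, abs_mul, abs_of_pos (by positivity : (0 : ℝ) < p.2 * q.2)]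
        rw [abs_mul, abs_of_nonneg (sq_nonneg A)] at hlt
        exact (mul_le_mul_of_nonneg_left hA (abs_nonneg _)).trans_lt hlt
      have hz : (p.1 : ℤ) * q.2 - q.1 * p.2 = 0 := by
        rw [← Int.abs_lt_one_iff]
        exact_mod_cast hcross
      have hN : p.1 * q.2 = q.1 * p.2 := by
        have : (p.1 : ℤ) * q.2 = q.1 * p.2 := by linarith
        exact_mod_cast this
      have d1 : p.2 ∣ q.2 :=
        (h3 p hp).symm.dvd_of_dvd_mul_left ⟨q.1, by rw [hN]; ring⟩
      have d2 : q.2 ∣ p.2 :=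
        (h3 q hq).symm.dvd_of_dvd_mul_left ⟨p.1, by rw [← hN]; ring⟩
      have e2 : p.2 = q.2 := Nat.dvd_antisymm d1 d2
      rw [e2] at hN
      have e1 : p.1 = q.1 := Nat.eq_of_mul_eq_mul_right (h1 q hq) hN
      exact Prod.ext e1 e2
  rw [card_range] at key
  have : (s.card : ℝ) ≤ (⌊2 * δ * A ^ 2⌋₊ : ℝ) + 1 := by exact_mod_cast key
  have := Nat.floor_le (show 0 ≤ 2 * δ * A ^ 2 by positivity)
  linarith

lemma card_le_sq_of_bounded (s : Finset (ℕ × ℕ)) {A : ℝ} (hA : 0 ≤ A)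
    (h : ∀ p ∈ s, 1 ≤ p.1 ∧ (p.1 : ℝ) ≤ A ∧ 1 ≤ p.2 ∧ (p.2 : ℝ) ≤ A) : (s.card : ℝ) ≤ A ^ 2 := by
  have h1 : s ⊆ Icc 1 ⌊A⌋₊ ×ˢ Icc 1 ⌊A⌋₊ := by
    intro p hp
    obtain ⟨a, b, c, d⟩ := h p hp
    simp only [mem_product, mem_Icc]
    exact ⟨⟨a, Nat.le_floor b⟩, c, Nat.le_floor d⟩
  have h2 := card_le_card h1
  rw [card_product, Nat.card_Icc, Nat.add_sub_cancel] at h2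
  have h3 : (s.card : ℝ) ≤ (⌊A⌋₊ : ℝ) * ⌊A⌋₊ := by exact_mod_cast h2
  have h4 := Nat.floor_le hA
  have : (0 : ℝ) ≤ ⌊A⌋₊ := by positivity
  nlinarith

lemma card_coprime_pairs_le (T : Finset ((ℕ × ℕ) × (ℕ × ℕ))) (F G : ℕ × ℕ → ℝ) {A B δ : ℝ}
    (hA : 0 ≤ A) (hB : 0 ≤ B) (hδ : 0 ≤ δ)
    (h1 : ∀ t ∈ T, 1 ≤ t.1.1 ∧ (t.1.1 : ℝ) ≤ A ∧ 1 ≤ t.1.2 ∧ (t.1.2 : ℝ) ≤ A)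
    (h2 : ∀ t ∈ T, 1 ≤ t.2.1 ∧ (t.2.1 : ℝ) ≤ B ∧ 1 ≤ t.2.2 ∧ (t.2.2 : ℝ) ≤ B)
    (hc1 : ∀ t ∈ T, t.1.1.Coprime t.1.2) (hc2 : ∀ t ∈ T, t.2.1.Coprime t.2.2)
    (hG : ∀ t ∈ T, |(t.1.1 : ℝ) / t.1.2 - G t.2| ≤ δ)
    (hF : ∀ t ∈ T, |(t.2.1 : ℝ) / t.2.2 - F t.1| ≤ δ) :
    (T.card : ℝ) ≤ A * B + 2 * δ * (A ^ 2 * B ^ 2) := by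
  have b1 : (T.card : ℝ) ≤ A ^ 2 * (1 + 2 * δ * B ^ 2) := by
    rw [card_eq_sum_card_image (fun t => t.1) T]
    push_cast
    have hf : ∀ p ∈ T.image (fun t => t.1), ((#{t ∈ T | t.1 = p} : ℕ) : ℝ) ≤ 1 + 2 * δ * B ^ 2 := by
      intro p _
      have hinj : Set.InjOn (fun t : (ℕ × ℕ) × (ℕ × ℕ) => t.2) (T.filter (fun t => t.1 = p)) := by
        intro a ha b hb hab
        rw [mem_coe, mem_filter] at ha hb
        exact Prod.ext (ha.2.trans hb.2.symm) hab
      rw [← card_image_of_injOn hinj]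
      apply card_coprime_near_le (x := F p) _ hδ
      all_goals
        intro q hq
        rw [mem_image] at hq
        obtain ⟨t, ht, rfl⟩ := hq
        rw [mem_filter] at ht
        obtain ⟨ht, rfl⟩ := ht
      · exact (h2 t ht).2.2.1
      · exact (h2 t ht).2.2.2
      · exact hc2 t ht
      · exact hF t ht
    refine (sum_le_sum hf).trans ?_
    rw [sum_const, nsmul_eq_mul]
    apply mul_le_mul_of_nonneg_right _ (by positivity)
    apply card_le_sq_of_bounded _ hA
    intro p hp
    obtain ⟨t, ht, rfl⟩ := mem_image.1 hp
    exact h1 t ht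
  have b2 : (T.card : ℝ) ≤ B ^ 2 * (1 + 2 * δ * A ^ 2) := by
    rw [card_eq_sum_card_image (fun t => t.2) T]
    push_cast
    have hf : ∀ p ∈ T.image (fun t => t.2), ((#{t ∈ T | t.2 = p} : ℕ) : ℝ) ≤ 1 + 2 * δ * A ^ 2 := by
      intro p _
      have hinj : Set.InjOn (fun t : (ℕ × ℕ) × (ℕ × ℕ) => t.1) (T.filter (fun t => t.2 = p)) := by
        intro a ha b hb hab
        rw [mem_coe, mem_filter] at ha hb
        exact Prod.ext hab (ha.2.trans hb.2.symm)
      rw [← card_image_of_injOn hinj]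
      apply card_coprime_near_le (x := G p) _ hδ
      all_goals
        intro q hq
        rw [mem_image] at hq
        obtain ⟨t, ht, rfl⟩ := hq
        rw [mem_filter] at ht
        obtain ⟨ht, rfl⟩ := ht
      · exact (h1 t ht).2.2.1
      · exact (h1 t ht).2.2.2
      · exact hc1 t ht
      · exact hG t ht
    refine (sum_le_sum hf).trans ?_
    rw [sum_const, nsmul_eq_mul]
    apply mul_le_mul_of_nonneg_right _ (by positivity)
    apply card_le_sq_of_bounded _ hB
    intro p hp
    obtain ⟨t, ht, rfl⟩ := mem_image.1 hp
    exact h2 t ht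
  rcases le_total A B with h | h <;> nlinarith

lemma mem_dyN {Y : ℝ} {n : ℕ} : n ∈ dyN Y ↔ Y / 2 ≤ (n : ℝ) ∧ (n : ℝ) < Y := by
  unfold dyN
  rw [mem_filter, mem_range, and_iff_right_iff_imp]
  rintro ⟨_, h⟩
  have : (n : ℝ) ≤ (⌈Y⌉₊ : ℝ) := h.le.trans (Nat.le_ceil Y)
  exact Nat.lt_succ_of_le (by exact_mod_cast this)

lemma one_le_of_mem_dyN {Y : ℝ} (hY : 1 ≤ Y) {n : ℕ} (h : n ∈ dyN Y) : 1 ≤ n := by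
  have := (mem_dyN.1 h).1
  have h2 : (0 : ℝ) < n := by linarith
  exact_mod_cast h2

lemma card_dyN_le {Y : ℝ} (hY : 1 ≤ Y) : ((dyN Y).card : ℝ) ≤ Y := by
  have h : dyN Y ⊆ Icc 1 ⌊Y⌋₊ := fun n hn =>
    mem_Icc.2 ⟨one_le_of_mem_dyN hY hn, Nat.le_floor (mem_dyN.1 hn).2.le⟩
  have h1 := card_le_card h
  rw [Nat.card_Icc, Nat.add_sub_cancel] at h1
  have h2 : ((dyN Y).card : ℝ) ≤ ⌊Y⌋₊ := by exact_mod_cast h1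
  exact h2.trans (Nat.floor_le (by linarith))

lemma abs_rpow_sub_rpow_le {c a b : ℝ} (hc1 : 1 ≤ c) (hc2 : c ≤ 9 / 8) (ha0 : 0 ≤ a) (ha : a ≤ 2)
    (hb0 : 0 ≤ b) (hb : b ≤ 2) : |a ^ c - b ^ c| ≤ 3 * |a - b| := by
  have := Convex.norm_image_sub_le_of_norm_hasDerivWithin_le (f := fun t : ℝ => t ^ c)
    (f' := fun t => c * t ^ (c - 1)) (s := Set.Icc 0 2) (C := 3) (x := b) (y := a)
    (fun t _ => (Real.hasDerivAt_rpow_const (Or.inr hc1)).hasDerivWithinAt)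
    (fun t ht => by
      have h1 : t ^ (c - 1) ≤ 2 ^ (c - 1) := Real.rpow_le_rpow ht.1 ht.2 (by linarith)
      have h2 : (2 : ℝ) ^ (c - 1) ≤ 2 ^ (1 : ℝ) :=
        Real.rpow_le_rpow_of_exponent_le (by norm_num) (by linarith)
      rw [Real.rpow_one] at h2
      have h3 : 0 ≤ t ^ (c - 1) := Real.rpow_nonneg ht.1 _
      rw [Real.norm_eq_abs, abs_of_nonneg (by positivity)]
      nlinarith)
    (convex_Icc 0 2) ⟨hb0, hb⟩ ⟨ha0, ha⟩
  simpa using this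

lemma card_close_pairs_le {γ V M δ : ℝ} (hγ0 : 8 / 9 < γ) (hγ1 : γ < 1) (hV : 1 ≤ V) (hM : 1 ≤ M)
    (hδ : 0 ≤ δ) (S : Finset ((ℕ × ℕ) × (ℕ × ℕ)))
    (hS : ∀ p ∈ S, p.1.1 ∈ dyN V ∧ p.1.2 ∈ dyN M ∧ p.2.1 ∈ dyN V ∧ p.2.2 ∈ dyN M)
    (hclose : ∀ p ∈ S, |(p.1.1 : ℝ) * (p.1.2 : ℝ) ^ γ - (p.2.1 : ℝ) * (p.2.2 : ℝ) ^ γ|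
      ≤ δ * (V * M ^ γ)) :
    (S.card : ℝ) ≤ (V * M + 24 * δ * (V ^ 2 * M ^ 2)) * ((1 + Real.log V) * (1 + Real.log M)) := by
  have hγp : 0 < γ := by linarith
  have hM0 : 0 < M := by linarith
  have hV0 : 0 < V := by linarith
  have hpos : ∀ p ∈ S, 1 ≤ p.1.1 ∧ 1 ≤ p.1.2 ∧ 1 ≤ p.2.1 ∧ 1 ≤ p.2.2 := fun p hp =>
    ⟨one_le_of_mem_dyN hV (hS p hp).1, one_le_of_mem_dyN hM (hS p hp).2.1,
      one_le_of_mem_dyN hV (hS p hp).2.2.1, one_le_of_mem_dyN hM (hS p hp).2.2.2⟩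
  -- the two ratios determine each other approximately
  have hratio1 : ∀ p ∈ S, |(p.1.1 : ℝ) / p.2.1 - ((p.2.2 : ℝ) / p.1.2) ^ γ| ≤ 12 * δ ∧
      |(p.1.1 : ℝ) / p.2.1 - ((p.2.2 : ℝ) / p.1.2) ^ γ| ≤ 4 * δ := by
    intro p hp
    obtain ⟨a, b, c, d⟩ := hS p hp
    obtain ⟨a', b', c', d'⟩ := hpos p hp
    have hb0 : (0 : ℝ) < p.1.2 := by exact_mod_cast b'
    have hc0 : (0 : ℝ) < p.2.1 := by exact_mod_cast c'
    have hbγ : 0 < (p.1.2 : ℝ) ^ γ := by positivity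
    have e1 : (p.1.1 : ℝ) / p.2.1 - ((p.2.2 : ℝ) / p.1.2) ^ γ =
        ((p.1.1 : ℝ) * (p.1.2 : ℝ) ^ γ - (p.2.1 : ℝ) * (p.2.2 : ℝ) ^ γ) /
          (p.2.1 * (p.1.2 : ℝ) ^ γ) := by
      rw [Real.div_rpow (by positivity) hb0.le]
      field_simp
    have h1 : M ^ γ / 2 ≤ (p.1.2 : ℝ) ^ γ := by
      have k1 : (M / 2) ^ γ ≤ (p.1.2 : ℝ) ^ γ :=
        Real.rpow_le_rpow (by positivity) (mem_dyN.1 b).1 hγp.le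
      rw [Real.div_rpow hM0.le (by norm_num)] at k1
      have k2 : (2 : ℝ) ^ γ ≤ 2 ^ (1 : ℝ) :=
        Real.rpow_le_rpow_of_exponent_le (by norm_num) hγ1.le
      rw [Real.rpow_one] at k2
      refine le_trans ?_ k1
      gcongr
    have h2 : V * M ^ γ / 4 ≤ p.2.1 * (p.1.2 : ℝ) ^ γ := by
      calc V * M ^ γ / 4 = (V / 2) * (M ^ γ / 2) := by ring
        _ ≤ _ := mul_le_mul (mem_dyN.1 c).1 h1 (by positivity) hc0.le
    have h3 : |(p.1.1 : ℝ) / p.2.1 - ((p.2.2 : ℝ) / p.1.2) ^ γ| ≤ 4 * δ := by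
      rw [e1, abs_div, abs_of_pos (by positivity : 0 < (p.2.1 : ℝ) * (p.1.2 : ℝ) ^ γ),
        div_le_iff₀ (by positivity)]
      refine (hclose p hp).trans ?_
      calc δ * (V * M ^ γ) = 4 * δ * (V * M ^ γ / 4) := by ring
        _ ≤ _ := by gcongr
    exact ⟨by linarith, h3⟩
  have hratio2 : ∀ p ∈ S, |(p.2.2 : ℝ) / p.1.2 - ((p.1.1 : ℝ) / p.2.1) ^ γ⁻¹| ≤ 12 * δ := by
    intro p hp
    obtain ⟨a, b, c, d⟩ := hS p hp
    obtain ⟨a', b', c', d'⟩ := hpos p hp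
    have hb0 : (0 : ℝ) < p.1.2 := by exact_mod_cast b'
    have hc0 : (0 : ℝ) < p.2.1 := by exact_mod_cast c'
    have hs2 : (p.2.2 : ℝ) / p.1.2 ≤ 2 := by
      rw [div_le_iff₀ hb0]
      linarith [(mem_dyN.1 b).1, (mem_dyN.1 d).2]
    have hr2 : (p.1.1 : ℝ) / p.2.1 ≤ 2 := by
      rw [div_le_iff₀ hc0]
      linarith [(mem_dyN.1 c).1, (mem_dyN.1 a).2]
    have hs0 : 0 ≤ (p.2.2 : ℝ) / p.1.2 := by positivity
    have hsγ : ((p.2.2 : ℝ) / p.1.2) ^ γ ≤ 2 := by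
      calc ((p.2.2 : ℝ) / p.1.2) ^ γ ≤ 2 ^ γ := Real.rpow_le_rpow hs0 hs2 hγp.le
        _ ≤ 2 ^ (1 : ℝ) := Real.rpow_le_rpow_of_exponent_le (by norm_num) hγ1.le
        _ = 2 := Real.rpow_one 2
    have hc1 : 1 ≤ γ⁻¹ := (one_le_inv₀ hγp).2 hγ1.le
    have hc2 : γ⁻¹ ≤ 9 / 8 := by
      rw [inv_le_comm₀ hγp (by norm_num)]; linarith
    have h := abs_rpow_sub_rpow_le hc1 hc2 (Real.rpow_nonneg hs0 γ) hsγ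
      (by positivity : 0 ≤ (p.1.1 : ℝ) / p.2.1) hr2
    rw [Real.rpow_rpow_inv hs0 hγp.ne', abs_sub_comm (_ ^ γ)] at h
    linarith [(hratio1 p hp).2]
  have hgcd1 : ∀ p ∈ S, 0 < Nat.gcd p.1.1 p.2.1 := fun p hp => Nat.gcd_pos_of_pos_left _ (hpos p hp).1
  have hgcd2 : ∀ p ∈ S, 0 < Nat.gcd p.2.2 p.1.2 := fun p hp =>
    Nat.gcd_pos_of_pos_left _ (hpos p hp).2.2.2
  have hmaps : ∀ p ∈ S, (Nat.gcd p.1.1 p.2.1, Nat.gcd p.2.2 p.1.2) ∈ Icc 1 ⌊V⌋₊ ×ˢ Icc 1 ⌊M⌋₊ := by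
    intro p hp
    obtain ⟨a, b, c, d⟩ := hS p hp
    obtain ⟨a', b', c', d'⟩ := hpos p hp
    simp only [mem_product, mem_Icc]
    refine ⟨⟨hgcd1 p hp, (Nat.gcd_le_left _ a').trans (Nat.le_floor (mem_dyN.1 a).2.le)⟩,
      hgcd2 p hp, (Nat.gcd_le_left _ d').trans (Nat.le_floor (mem_dyN.1 d).2.le)⟩
  rw [card_eq_sum_card_fiberwise hmaps]
  push_cast
  have hfib : ∀ q ∈ Icc 1 ⌊V⌋₊ ×ˢ Icc 1 ⌊M⌋₊,
      ((#{p ∈ S | (Nat.gcd p.1.1 p.2.1, Nat.gcd p.2.2 p.1.2) = q} : ℕ) : ℝ) ≤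
        (V * M + 24 * δ * (V ^ 2 * M ^ 2)) * ((q.1 : ℝ)⁻¹ * (q.2 : ℝ)⁻¹) := by
    rintro ⟨g, k⟩ hq
    simp only [mem_product, mem_Icc] at hq
    have hg : (1 : ℝ) ≤ g := by exact_mod_cast hq.1.1
    have hk : (1 : ℝ) ≤ k := by exact_mod_cast hq.2.1
    have hinj : Set.InjOn
        (fun p : (ℕ × ℕ) × (ℕ × ℕ) => ((p.1.1 / g, p.2.1 / g), (p.2.2 / k, p.1.2 / k)))
        (S.filter fun p => (Nat.gcd p.1.1 p.2.1, Nat.gcd p.2.2 p.1.2) = (g, k)) := by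
      rintro ⟨⟨a, b⟩, c, d⟩ hp ⟨⟨a', b'⟩, c', d'⟩ hp' heq
      simp only [coe_filter, Set.mem_ofPred_eq, Prod.mk.injEq] at hp hp' heq
      obtain ⟨-, rfl, rfl⟩ := hp
      obtain ⟨-, h1, h2⟩ := hp'
      obtain ⟨⟨e1, e2⟩, e3, e4⟩ := heq
      have f1 := Nat.div_left_inj (Nat.gcd_dvd_left a c) (h1 ▸ Nat.gcd_dvd_left a' c') |>.1 e1
      have f2 := Nat.div_left_inj (Nat.gcd_dvd_right a c) (h1 ▸ Nat.gcd_dvd_right a' c') |>.1 e2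
      have f3 := Nat.div_left_inj (Nat.gcd_dvd_left d b) (h2 ▸ Nat.gcd_dvd_left d' b') |>.1 e3
      have f4 := Nat.div_left_inj (Nat.gcd_dvd_right d b) (h2 ▸ Nat.gcd_dvd_right d' b') |>.1 e4
      rw [f1, f2, f3, f4]
    rw [← card_image_of_injOn hinj]
    have hb := card_coprime_pairs_le ((S.filter fun p =>
        (Nat.gcd p.1.1 p.2.1, Nat.gcd p.2.2 p.1.2) = (g, k)).image
          (fun p : (ℕ × ℕ) × (ℕ × ℕ) => ((p.1.1 / g, p.2.1 / g), (p.2.2 / k, p.1.2 / k))))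
      (fun q => ((q.1 : ℝ) / q.2) ^ γ⁻¹) (fun q => ((q.1 : ℝ) / q.2) ^ γ) (A := V / g) (B := M / k)
      (δ := 12 * δ) (by positivity) (by positivity) (by positivity)
    have hcast : ∀ {x y : ℕ}, 0 < y → y ∣ x → ((x / y : ℕ) : ℝ) = (x : ℝ) / y := by
      intro x y hy hxy
      exact Nat.cast_div hxy (by positivity)
    have hquot : ∀ {x y z : ℕ}, 0 < z → z ∣ x → z ∣ y →
        ((x / z : ℕ) : ℝ) / ((y / z : ℕ) : ℝ) = (x : ℝ) / y := by
      intro x y z hz h1 h2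
      rw [hcast hz h1, hcast hz h2]
      have : (z : ℝ) ≠ 0 := by positivity
      field_simp
    have hb := hb ?_ ?_ ?_ ?_ ?_ ?_
    · refine hb.trans ?_
      have hgi : (g : ℝ)⁻¹ ≤ 1 := inv_le_one_of_one_le₀ hg
      have hki : (k : ℝ)⁻¹ ≤ 1 := inv_le_one_of_one_le₀ hk
      have hgk : (g : ℝ)⁻¹ * (k : ℝ)⁻¹ ≤ 1 := mul_le_one₀ hgi (by positivity) hki
      have hgk0 : 0 ≤ (g : ℝ)⁻¹ * (k : ℝ)⁻¹ := by positivity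
      have e1 : V / g * (M / k) + 2 * (12 * δ) * ((V / g) ^ 2 * (M / k) ^ 2)
          = V * M * ((g : ℝ)⁻¹ * (k : ℝ)⁻¹)
            + 24 * δ * (V ^ 2 * M ^ 2) * (((g : ℝ)⁻¹ * (k : ℝ)⁻¹) * ((g : ℝ)⁻¹ * (k : ℝ)⁻¹)) := by
        simp only [div_eq_mul_inv]; ring
      rw [e1, add_mul]
      exact add_le_add le_rfl (mul_le_mul_of_nonneg_left (mul_le_of_le_one_right hgk0 hgk)
        (by positivity))
    all_goals
      intro t ht
      rw [mem_image] at ht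
      obtain ⟨p, hp, rfl⟩ := ht
      rw [mem_filter, Prod.mk.injEq] at hp
      obtain ⟨hp, rfl, rfl⟩ := hp
      obtain ⟨a, b, c, d⟩ := hS p hp
      obtain ⟨a', b', c', d'⟩ := hpos p hp
      have g1 := hgcd1 p hp
      have g2 := hgcd2 p hp
      have d1 := Nat.gcd_dvd_left p.1.1 p.2.1
      have d2 := Nat.gcd_dvd_right p.1.1 p.2.1
      have d3 := Nat.gcd_dvd_left p.2.2 p.1.2
      have d4 := Nat.gcd_dvd_right p.2.2 p.1.2
      dsimp only
    · rw [hcast g1 d1, hcast g1 d2]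
      refine ⟨Nat.div_pos (Nat.le_of_dvd a' d1) g1, ?_, Nat.div_pos (Nat.le_of_dvd c' d2) g1, ?_⟩
      · gcongr; exact (mem_dyN.1 a).2.le
      · gcongr; exact (mem_dyN.1 c).2.le
    · rw [hcast g2 d3, hcast g2 d4]
      refine ⟨Nat.div_pos (Nat.le_of_dvd d' d3) g2, ?_, Nat.div_pos (Nat.le_of_dvd b' d4) g2, ?_⟩
      · gcongr; exact (mem_dyN.1 d).2.le
      · gcongr; exact (mem_dyN.1 b).2.le
    · exact Nat.coprime_div_gcd_div_gcd g1
    · exact Nat.coprime_div_gcd_div_gcd g2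
    · rw [hquot g1 d1 d2, hquot g2 d3 d4]
      exact (hratio1 p hp).1
    · rw [hquot g1 d1 d2, hquot g2 d3 d4]
      exact hratio2 p hp
  refine (sum_le_sum hfib).trans ?_
  rw [← mul_sum, sum_product]
  simp only [← mul_sum]
  rw [← sum_mul]
  have hharm : ∀ Y : ℝ, 1 ≤ Y → ∑ i ∈ Icc 1 ⌊Y⌋₊, (i : ℝ)⁻¹ ≤ 1 + Real.log Y := by
    intro Y hY
    have := harmonic_floor_le_one_add_log Y hY
    rw [harmonic_eq_sum_Icc] at this
    push_cast at this
    exact this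
  have hlogV := Real.log_nonneg hV
  apply mul_le_mul_of_nonneg_left _ (by positivity)
  exact mul_le_mul (hharm V hV) (hharm M hM) (by positivity) (by positivity)

/-- Cauchy-Schwarz after splitting the inner sum into cells. -/
lemma norm_sq_sum_le_cells {ι : Type*} [DecidableEq ι] (P : Finset ι) (S : Finset ℕ) (Q : ℕ)
    (cell : ι → ℕ) (hcell : ∀ p ∈ P, cell p < Q) (b : ℕ → ℂ) (hb : ∀ n ∈ S, ‖b n‖ ≤ 1)
    (z : ι → ℕ → ℂ) :
    ‖∑ n ∈ S, b n * ∑ p ∈ P, z p n‖ ^ 2 ≤ S.card * Q *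
      ∑ t ∈ P ×ˢ P with cell t.1 = cell t.2, ‖∑ n ∈ S, z t.1 n * (starRingEnd ℂ) (z t.2 n)‖ := by
  have hmaps : ∀ p ∈ P, cell p ∈ range Q := fun p hp => mem_range.2 (hcell p hp)
  set w : ℕ × ℕ → ℂ := fun x => ∑ p ∈ P with cell p = x.2, z p x.1 with hw
  have h1 : ‖∑ n ∈ S, b n * ∑ p ∈ P, z p n‖ ≤ ∑ x ∈ S ×ˢ range Q, ‖w x‖ := by
    rw [sum_product]
    refine norm_sum_le_of_le _ fun n hn => ?_
    rw [norm_mul, ← sum_fiberwise_of_maps_to hmaps]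
    exact (mul_le_of_le_one_left (norm_nonneg _) (hb n hn)).trans (norm_sum_le _ _)
  have h2 : (∑ x ∈ S ×ˢ range Q, ‖w x‖) ^ 2 ≤ S.card * Q * ∑ x ∈ S ×ˢ range Q, ‖w x‖ ^ 2 := by
    have := sq_sum_le_card_mul_sum_sq (s := S ×ˢ range Q) (f := fun x => ‖w x‖)
    rw [card_product, card_range] at this
    exact_mod_cast this
  have h3 : ((∑ x ∈ S ×ˢ range Q, ‖w x‖ ^ 2 : ℝ) : ℂ) =
      ∑ t ∈ P ×ˢ P with cell t.1 = cell t.2, ∑ n ∈ S, z t.1 n * (starRingEnd ℂ) (z t.2 n) := by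
    have hmaps2 : ∀ t ∈ (P ×ˢ P).filter (fun t => cell t.1 = cell t.2), cell t.1 ∈ range Q :=
      fun t ht => hmaps _ (mem_product.1 (mem_filter.1 ht).1).1
    rw [← sum_fiberwise_of_maps_to hmaps2, sum_product_right]
    push_cast
    refine sum_congr rfl fun q _ => ?_
    have hset : ((P ×ˢ P).filter (fun t => cell t.1 = cell t.2)).filter (fun t => cell t.1 = q) =
        P.filter (fun p => cell p = q) ×ˢ P.filter (fun p => cell p = q) := by
      ext ⟨p, p'⟩
      simp only [mem_filter, mem_product]
      constructor
      · rintro ⟨⟨⟨h1, h2⟩, h3⟩, h4⟩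
        exact ⟨⟨h1, h4⟩, h2, h3 ▸ h4⟩
      · rintro ⟨⟨h1, h4⟩, h2, h5⟩
        exact ⟨⟨⟨h1, h2⟩, h4.trans h5.symm⟩, h4⟩
    rw [hset, sum_comm]
    refine sum_congr rfl fun n _ => ?_
    rw [← Complex.mul_conj', hw, map_sum, sum_mul_sum, sum_product]
  have h4 : ∑ x ∈ S ×ˢ range Q, ‖w x‖ ^ 2 ≤
      ∑ t ∈ P ×ˢ P with cell t.1 = cell t.2, ‖∑ n ∈ S, z t.1 n * (starRingEnd ℂ) (z t.2 n)‖ := by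
    refine le_trans ?_ (norm_sum_le _ _)
    rw [← h3, Complex.norm_real]
    exact le_abs_self _
  calc _ ≤ (∑ x ∈ S ×ˢ range Q, ‖w x‖) ^ 2 := by gcongr
    _ ≤ _ := h2
    _ ≤ _ := by gcongr

lemma bilinear_norm_sq_le {γ : ℝ} (hγ0 : 8 / 9 < γ) (hγ1 : γ < 1) :
    ∃ C > (0 : ℝ), ∀ X M N V : ℝ, 1 ≤ M → 1 ≤ N → 1 ≤ V → ∀ Q : ℕ, 1 ≤ Q →
      ∀ a b d : ℕ → ℂ, (∀ m ∈ dyN M, ‖a m‖ ≤ 1) → (∀ n ∈ dyN N, ‖b n‖ ≤ 1) →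
      (∀ h ∈ dyN V, ‖d h‖ ≤ 1) →
      ‖∑ m ∈ dyN M, ∑ n ∈ (dyN N).filter (fun n => X / 2 ≤ ((m * n : ℕ) : ℝ) ∧ ((m * n : ℕ) : ℝ) < X),
        ∑ h ∈ dyN V, a m * b n * d h * e ((h : ℝ) * ((m : ℝ) * (n : ℝ)) ^ γ)‖ ^ 2 ≤
      N * Q * (((1 + Real.log V) * (1 + Real.log M)) * (25 * (V * M) * N +
        (V * M + 24 * (1 / Q) * (V ^ 2 * M ^ 2)) *
          (C * (√(V * M ^ γ / Q * N ^ γ) + N / √(M ^ γ / M * N ^ γ))))) := by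
  have hγp : 0 < γ := by linarith
  obtain ⟨C, hC, hvdc⟩ := norm_sum_e_mul_rpow_le hγp hγ1
  refine ⟨C, hC, ?_⟩
  intro X M N V hM hN hV Q hQ a b d ha hb hd
  have hM0 : 0 < M := by linarith
  have hN0 : 0 < N := by linarith
  have hV0 : 0 < V := by linarith
  have hQ0 : (0 : ℝ) < Q := by exact_mod_cast hQ
  have hMγ : 0 < M ^ γ := by positivity
  have hNγ : 0 < N ^ γ := by positivity
  set w : ℝ := V * M ^ γ / Q with hw
  have hw0 : 0 < w := by positivity
  set P : Finset (ℕ × ℕ) := dyN V ×ˢ dyN M with hP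
  set val : ℕ × ℕ → ℝ := fun p => (p.1 : ℝ) * (p.2 : ℝ) ^ γ with hval
  have hval0 : ∀ p, 0 ≤ val p := fun p => by simp only [hval]; positivity
  set cell : ℕ × ℕ → ℕ := fun p => ⌊val p / w⌋₊ with hcelldef
  have hcell : ∀ p ∈ P, cell p < Q := by
    intro p hp
    obtain ⟨h1, h2⟩ := mem_product.1 hp
    rw [hcelldef, Nat.floor_lt (by have := hval0 p; positivity), div_lt_iff₀ hw0, hw,
      mul_div_cancel₀ _ hQ0.ne']
    have k1 : (p.2 : ℝ) ^ γ ≤ M ^ γ := Real.rpow_le_rpow (by positivity) (mem_dyN.1 h2).2.le hγp.le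
    calc (p.1 : ℝ) * (p.2 : ℝ) ^ γ ≤ p.1 * M ^ γ := by gcongr
      _ < V * M ^ γ := by gcongr; exact (mem_dyN.1 h1).2
  set cond : ℕ → ℕ → Prop := fun m n => X / 2 ≤ ((m * n : ℕ) : ℝ) ∧ ((m * n : ℕ) : ℝ) < X with hcond
  classical
  set z : ℕ × ℕ → ℕ → ℂ := fun p n =>
    if cond p.2 n then a p.2 * d p.1 * e (val p * (n : ℝ) ^ γ) else 0 with hz
  have hsum : ∑ m ∈ dyN M, ∑ n ∈ (dyN N).filter (fun n => cond m n),
        ∑ h ∈ dyN V, a m * b n * d h * e ((h : ℝ) * ((m : ℝ) * (n : ℝ)) ^ γ)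
      = ∑ n ∈ dyN N, b n * ∑ p ∈ P, z p n := by
    simp only [sum_filter]
    rw [sum_comm]
    refine sum_congr rfl fun n _ => ?_
    rw [hP, sum_product_right, mul_sum]
    refine sum_congr rfl fun m _ => ?_
    simp only [hz]
    split_ifs with hc
    · rw [mul_sum]
      refine sum_congr rfl fun h _ => ?_
      rw [Real.mul_rpow (by positivity) (by positivity)]
      simp only [hval]
      rw [mul_assoc (h : ℝ)]
      ring
    · simp
  rw [hsum]
  refine (norm_sq_sum_le_cells P (dyN N) Q cell hcell b hb z).trans ?_
  set S := (P ×ˢ P).filter (fun t => cell t.1 = cell t.2) with hS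
  have hSmem : ∀ t ∈ S, t.1.1 ∈ dyN V ∧ t.1.2 ∈ dyN M ∧ t.2.1 ∈ dyN V ∧ t.2.2 ∈ dyN M := by
    intro t ht
    rw [hS, mem_filter, mem_product, hP, mem_product, mem_product] at ht
    exact ⟨ht.1.1.1, ht.1.1.2, ht.1.2.1, ht.1.2.2⟩
  have hSclose : ∀ t ∈ S, |val t.1 - val t.2| ≤ w := by
    intro t ht
    have hc := (mem_filter.1 ht).2
    simp only [hcelldef] at hc
    have p1 : 0 ≤ val t.1 / w := div_nonneg (hval0 _) hw0.le
    have p2 : 0 ≤ val t.2 / w := div_nonneg (hval0 _) hw0.le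
    have f1 := Nat.floor_le p1
    have f2 := Nat.lt_floor_add_one (val t.1 / w)
    have f3 := Nat.floor_le p2
    have f4 := Nat.lt_floor_add_one (val t.2 / w)
    rw [hc] at f1 f2
    have : |val t.1 / w - val t.2 / w| ≤ 1 := by
      rw [abs_le]; constructor <;> linarith
    rw [← sub_div, abs_div, abs_of_pos hw0, div_le_one hw0] at this
    exact this
  -- each inner sum is, up to a factor of modulus at most one, an exponential sum over an interval
  have hterm : ∀ t ∈ S, ∃ u v : ℕ, (∀ n ∈ Ico u v, N / 2 ≤ (n : ℝ) ∧ (n : ℝ) < N) ∧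
      ‖∑ n ∈ dyN N, z t.1 n * (starRingEnd ℂ) (z t.2 n)‖ ≤
        ‖∑ n ∈ Ico u v, e ((val t.1 - val t.2) * (n : ℝ) ^ γ)‖ := by
    intro t ht
    obtain ⟨m1, m2, m3, m4⟩ := hSmem t ht
    obtain ⟨u, v, huv⟩ := exists_eq_Ico_of_convex
      ((dyN N).filter fun n => cond t.1.2 n ∧ cond t.2.2 n) (by
        intro p hp q hq n h1 h2
        rw [mem_filter, mem_dyN] at hp hq ⊢
        have c1 : (p : ℝ) ≤ n := by exact_mod_cast h1
        have c2 : (n : ℝ) ≤ q := by exact_mod_cast h2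
        have c3 : ∀ m : ℕ, ((m * p : ℕ) : ℝ) ≤ ((m * n : ℕ) : ℝ) := fun m => by
          exact_mod_cast Nat.mul_le_mul_left m h1
        have c4 : ∀ m : ℕ, ((m * n : ℕ) : ℝ) ≤ ((m * q : ℕ) : ℝ) := fun m => by
          exact_mod_cast Nat.mul_le_mul_left m h2
        exact ⟨⟨hp.1.1.trans c1, c2.trans_lt hq.1.2⟩,
          ⟨hp.2.1.1.trans (c3 _), (c4 _).trans_lt hq.2.1.2⟩,
          ⟨hp.2.2.1.trans (c3 _), (c4 _).trans_lt hq.2.2.2⟩⟩)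
    refine ⟨u, v, ?_, ?_⟩
    · intro n hn
      rw [← huv] at hn
      exact mem_dyN.1 (mem_filter.1 hn).1
    · have e1 : ∑ n ∈ dyN N, z t.1 n * (starRingEnd ℂ) (z t.2 n) =
          (a t.1.2 * d t.1.1 * (starRingEnd ℂ) (a t.2.2 * d t.2.1)) *
            ∑ n ∈ Ico u v, e ((val t.1 - val t.2) * (n : ℝ) ^ γ) := by
        rw [← huv, sum_filter, mul_sum]
        refine sum_congr rfl fun n _ => ?_
        by_cases k1 : cond t.1.2 n
        · by_cases k2 : cond t.2.2 n
          · simp only [hz, k1, k2, and_self, if_true, map_mul, conj_e]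
            rw [sub_mul, sub_eq_add_neg, e_add]
            ring
          · simp [hz, k2]
        · simp [hz, k1]
      rw [e1, norm_mul]
      apply mul_le_of_le_one_left (norm_nonneg _)
      rw [norm_mul, Complex.norm_conj, norm_mul, norm_mul]
      have n1 := mul_le_one₀ (ha _ m2) (norm_nonneg _) (hd _ m1)
      have n2 := mul_le_one₀ (ha _ m4) (norm_nonneg _) (hd _ m3)
      exact mul_le_one₀ n1 (by positivity) n2
  set f : (ℕ × ℕ) × (ℕ × ℕ) → ℝ := fun t =>
    ‖∑ n ∈ dyN N, z t.1 n * (starRingEnd ℂ) (z t.2 n)‖ with hf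
  set E : ℝ := C * (√(w * N ^ γ) + N / √(M ^ γ / M * N ^ γ)) with hE
  have hE0 : 0 ≤ E := by positivity
  have htriv : ∀ t ∈ S, f t ≤ N := by
    intro t ht
    obtain ⟨u, v, h1, h2⟩ := hterm t ht
    refine h2.trans ((norm_sum_le _ _).trans ?_)
    simp only [norm_e, sum_const, nsmul_eq_mul, mul_one]
    have hsub : Ico u v ⊆ dyN N := fun n hn => mem_dyN.2 (h1 n hn)
    have : ((Ico u v).card : ℝ) ≤ (dyN N).card := by exact_mod_cast card_le_card hsub
    exact this.trans (card_dyN_le hN)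
  have hfar : ∀ t ∈ S, M ^ γ / M < |val t.1 - val t.2| → f t ≤ E := by
    intro t ht hlt
    obtain ⟨u, v, h1, h2⟩ := hterm t ht
    have hpos : 0 < M ^ γ / M := by positivity
    have hne : val t.1 - val t.2 ≠ 0 := abs_pos.1 (hpos.trans hlt)
    refine h2.trans ((hvdc N hN u v h1 _ hne).trans ?_)
    have hcl := hSclose t ht
    rw [hE]
    gcongr
  set L : ℝ := (1 + Real.log V) * (1 + Real.log M) with hL
  have hcardS : (S.card : ℝ) ≤ (V * M + 24 * (1 / Q) * (V ^ 2 * M ^ 2)) * L := by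
    apply card_close_pairs_le hγ0 hγ1 hV hM (by positivity) S hSmem
    intro t ht
    refine (hSclose t ht).trans_eq ?_
    rw [hw]; ring
  have hcardnear : ((S.filter fun t => ¬ M ^ γ / M < |val t.1 - val t.2|).card : ℝ) ≤
      25 * (V * M) * L := by
    have := card_close_pairs_le hγ0 hγ1 hV hM (δ := 1 / (V * M)) (by positivity)
      (S.filter fun t => ¬ M ^ γ / M < |val t.1 - val t.2|)
      (fun t ht => hSmem t (mem_filter.1 ht).1)
      (fun t ht => by
        refine (not_lt.1 (mem_filter.1 ht).2).trans_eq ?_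
        field_simp)
    refine this.trans_eq ?_
    rw [← hL]
    congr 1
    field_simp
    ring
  have hfsum : ∑ t ∈ S, f t ≤ L * (25 * (V * M) * N +
      (V * M + 24 * (1 / Q) * (V ^ 2 * M ^ 2)) * E) := by
    rw [← sum_filter_add_sum_filter_not S (fun t => M ^ γ / M < |val t.1 - val t.2|)]
    have s1 : ∑ t ∈ S with M ^ γ / M < |val t.1 - val t.2|, f t ≤
        ((V * M + 24 * (1 / Q) * (V ^ 2 * M ^ 2)) * L) * E := by
      refine (sum_le_card_nsmul _ _ E fun t ht =>
        hfar t (mem_filter.1 ht).1 (mem_filter.1 ht).2).trans ?_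
      rw [nsmul_eq_mul]
      apply mul_le_mul_of_nonneg_right _ hE0
      refine le_trans ?_ hcardS
      exact_mod_cast card_le_card (filter_subset _ _)
    have s2 : ∑ t ∈ S with ¬ M ^ γ / M < |val t.1 - val t.2|, f t ≤ (25 * (V * M) * L) * N := by
      refine (sum_le_card_nsmul _ _ N fun t ht => htriv t (mem_filter.1 ht).1).trans ?_
      rw [nsmul_eq_mul]
      exact mul_le_mul_of_nonneg_right hcardnear hN0.le
    linarith
  have hL0 : 0 ≤ L := by
    have := Real.log_nonneg hV
    have := Real.log_nonneg hM
    positivity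
  have hcN := card_dyN_le hN
  exact mul_le_mul (mul_le_mul_of_nonneg_right hcN hQ0.le) hfsum
    (sum_nonneg fun t _ => norm_nonneg _) (by positivity)

lemma one_add_log_le {s t : ℝ} (hs : 0 < s) (ht : 1 ≤ t) :
    1 + Real.log t ≤ (1 + 1 / s) * t ^ s := by
  have h1 := Real.log_le_rpow_div (zero_le_one.trans ht) hs
  have h2 : 1 ≤ t ^ s := Real.one_le_rpow ht hs.le
  have h3 : (1 + 1 / s) * t ^ s = t ^ s + t ^ s / s := by ring
  linarith

lemma bilinear_bound_numeric {γ C : ℝ} (hγ0 : 8 / 9 < γ) (hγ1 : γ < 1) (hC : 0 < C) :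
    ∃ K > (0 : ℝ), ∀ x M N V : ℝ, 1 ≤ x → 1 ≤ M → 1 ≤ N → 1 ≤ V →
      x ^ ((7 : ℝ) / 22) ≤ M → M ≤ x ^ ((8 : ℝ) / 22) → x / (2 * M) ≤ N → N ≤ 4 * x / M →
      V ≤ 12 * x ^ (1 - γ + 1 / 10000) → ∃ Q : ℕ, 1 ≤ Q ∧
      N * Q * (((1 + Real.log V) * (1 + Real.log M)) * (25 * (V * M) * N +
        (V * M + 24 * (1 / Q) * (V ^ 2 * M ^ 2)) *
          (C * (√(V * M ^ γ / Q * N ^ γ) + N / √(M ^ γ / M * N ^ γ))))) ≤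
      K * (x ^ ((1 : ℝ) - 2 * (1 / 10000))) ^ 2 := by
  set B : ℝ := 12 * 1001 ^ 2 with hB
  refine ⟨25 * 2 * 12 * 16 * B + 26 * 144 * 4 * B * C * 7 + 26 * 144 * 16 * B * C * 2,
    by positivity, ?_⟩
  intro x M N V hx hM hN hV hM1 hM2 hN1 hN2 hVx
  have hx0 : 0 < x := by linarith
  have hM0 : 0 < M := by linarith
  have hN0 : 0 < N := by linarith
  have hV0 : 0 < V := by linarith
  have hexp : ∀ {p q : ℝ}, p ≤ q → x ^ p ≤ x ^ q := fun h =>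
    Real.rpow_le_rpow_of_exponent_le hx h
  set q : ℝ := 39 / 200 with hq
  have hxq : 1 ≤ x ^ q := Real.one_le_rpow hx (by norm_num)
  have hQlo : x ^ q ≤ (⌈x ^ q⌉₊ : ℝ) := Nat.le_ceil _
  have hQhi : (⌈x ^ q⌉₊ : ℝ) ≤ 2 * x ^ q := by
    have := Nat.ceil_lt_add_one (show 0 ≤ x ^ q by positivity)
    linarith
  refine ⟨⌈x ^ q⌉₊, Nat.one_le_ceil_iff.2 (by linarith), ?_⟩
  set Q : ℝ := (⌈x ^ q⌉₊ : ℝ) with hQ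
  have hQ0 : 0 < Q := by linarith
  set L : ℝ := (1 + Real.log V) * (1 + Real.log M) with hL
  set v : ℝ := 1 / 9 + 1 / 10000 with hv
  have hVv : V ≤ 12 * x ^ v := by
    refine hVx.trans ?_
    have := hexp (show 1 - γ + 1 / 10000 ≤ v by rw [hv]; linarith)
    linarith
  have hP1 : x / 2 ≤ M * N := by
    rw [div_le_iff₀ (by positivity)] at hN1; linarith
  have hP2 : M * N ≤ 4 * x := by
    rw [le_div_iff₀ hM0] at hN2; linarith
  have hP0 : 0 < M * N := by positivity
  have hlogV := Real.log_nonneg hV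
  have hlogM := Real.log_nonneg hM
  have hL0 : 0 ≤ L := by positivity
  have hLB : L ≤ B * x ^ (1 / 1000 : ℝ) := by
    have l1 := one_add_log_le (s := 1 / 1000) (by norm_num) hV
    have l2 := one_add_log_le (s := 1 / 1000) (by norm_num) hM
    have l3 : V ^ (1 / 1000 : ℝ) ≤ 12 * x ^ (1 / 2000 : ℝ) := by
      calc V ^ (1 / 1000 : ℝ) ≤ (12 * x ^ v) ^ (1 / 1000 : ℝ) :=
            Real.rpow_le_rpow hV0.le hVv (by norm_num)
        _ = 12 ^ (1 / 1000 : ℝ) * x ^ (v * (1 / 1000)) := by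
            rw [Real.mul_rpow (by norm_num) (by positivity), ← Real.rpow_mul hx0.le]
        _ ≤ 12 ^ (1 : ℝ) * x ^ (1 / 2000 : ℝ) := by
            gcongr
            · norm_num
            · norm_num
            · rw [hv]; norm_num
        _ = _ := by rw [Real.rpow_one]
    have l4 : M ^ (1 / 1000 : ℝ) ≤ x ^ (1 / 2000 : ℝ) := by
      calc M ^ (1 / 1000 : ℝ) ≤ (x ^ ((8 : ℝ) / 22)) ^ (1 / 1000 : ℝ) :=
            Real.rpow_le_rpow hM0.le hM2 (by norm_num)
        _ = x ^ ((8 : ℝ) / 22 * (1 / 1000)) := by rw [← Real.rpow_mul hx0.le]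
        _ ≤ _ := hexp (by norm_num)
    calc L ≤ ((1 + 1 / (1 / 1000)) * V ^ (1 / 1000 : ℝ)) * ((1 + 1 / (1 / 1000)) * M ^ (1 / 1000 : ℝ)) :=
          mul_le_mul l1 l2 (by positivity) (by positivity)
      _ ≤ ((1 + 1 / (1 / 1000)) * (12 * x ^ (1 / 2000 : ℝ))) *
            ((1 + 1 / (1 / 1000)) * x ^ (1 / 2000 : ℝ)) := by gcongr
      _ = B * (x ^ (1 / 2000 : ℝ) * x ^ (1 / 2000 : ℝ)) := by rw [hB]; ring
      _ = _ := by rw [← Real.rpow_add hx0]; norm_num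
  have hQM : Q ≤ 2 * M := by
    have := hexp (show q ≤ 7 / 22 by rw [hq]; norm_num)
    linarith
  have hPγ : (M * N) ^ γ = M ^ γ * N ^ γ := Real.mul_rpow hM0.le hN0.le
  have hlead : N * Q * (V * M + 24 * (1 / Q) * (V ^ 2 * M ^ 2)) ≤ 26 * V ^ 2 * M * (M * N) := by
    have e1 : N * Q * (V * M + 24 * (1 / Q) * (V ^ 2 * M ^ 2)) =
        N * M * V * (Q * 1) + 24 * V ^ 2 * M * (M * N) := by
      field_simp
    have e2 : N * M * V * (Q * 1) ≤ N * M * V * (2 * M * V) := by gcongr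
    rw [e1]; linarith
  have hsq2 : √(V * M ^ γ / Q * N ^ γ) ≤ 7 * x ^ ((1 + 1 / 10000 - q) / 2) := by
    have k1 : (M * N) ^ γ ≤ 4 * x ^ γ := by
      calc (M * N) ^ γ ≤ (4 * x) ^ γ := Real.rpow_le_rpow hP0.le hP2 (by linarith)
        _ = 4 ^ γ * x ^ γ := Real.mul_rpow (by norm_num) hx0.le
        _ ≤ 4 ^ (1 : ℝ) * x ^ γ := by gcongr; norm_num
        _ = _ := by rw [Real.rpow_one]
    have k2 : V * M ^ γ / Q * N ^ γ ≤ 12 * x ^ (1 - γ + 1 / 10000) * (4 * x ^ γ) / x ^ q := by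
      calc V * M ^ γ / Q * N ^ γ = V * (M * N) ^ γ / Q := by rw [hPγ]; ring
        _ ≤ _ := by gcongr
    have k3 : 12 * x ^ (1 - γ + 1 / 10000) * (4 * x ^ γ) / x ^ q = 48 * x ^ (1 + 1 / 10000 - q) := by
      have k4 : x ^ (1 + 1 / 10000 - q) = x ^ (1 - γ + 1 / 10000) * x ^ γ / x ^ q := by
        rw [← Real.rpow_add hx0, ← Real.rpow_sub hx0]
        congr 1
        ring
      rw [k4]
      ring
    rw [k3] at k2
    apply Real.sqrt_le_iff.2 ⟨by positivity, k2.trans ?_⟩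
    rw [mul_pow, ← Real.rpow_natCast (x ^ _), ← Real.rpow_mul hx0.le]
    push_cast
    rw [div_mul_cancel₀ _ (two_ne_zero)]
    have : 0 < x ^ (1 + 1 / 10000 - q) := by positivity
    linarith
  have hsq3 : 1 / √(M ^ γ / M * N ^ γ) ≤ 2 * x ^ (-((8 / 9 - 8 / 22) / 2) : ℝ) := by
    have k1 : x ^ (8 / 9 : ℝ) / 2 ≤ (M * N) ^ γ := by
      calc x ^ (8 / 9 : ℝ) / 2 ≤ x ^ γ / 2 ^ (1 : ℝ) := by
            rw [Real.rpow_one]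
            have := hexp hγ0.le
            linarith
        _ ≤ x ^ γ / 2 ^ γ := by gcongr; norm_num
        _ = (x / 2) ^ γ := by rw [Real.div_rpow hx0.le (by norm_num)]
        _ ≤ _ := Real.rpow_le_rpow (by positivity) hP1 (by linarith)
    have k2 : (x ^ ((8 / 9 - 8 / 22) / 2 : ℝ) / 2) ^ 2 ≤ M ^ γ / M * N ^ γ := by
      calc (x ^ ((8 / 9 - 8 / 22) / 2 : ℝ) / 2) ^ 2 = x ^ (8 / 9 - 8 / 22 : ℝ) / 4 := by
            rw [div_pow, ← Real.rpow_natCast (x ^ _), ← Real.rpow_mul hx0.le]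
            norm_num
        _ = x ^ (8 / 9 : ℝ) / 4 / x ^ ((8 : ℝ) / 22) := by rw [Real.rpow_sub hx0]; ring
        _ ≤ x ^ (8 / 9 : ℝ) / 2 / x ^ ((8 : ℝ) / 22) := by gcongr; norm_num
        _ ≤ (M * N) ^ γ / M := by gcongr
        _ = _ := by rw [hPγ]; ring
    have k3 := Real.le_sqrt_of_sq_le k2
    calc 1 / √(M ^ γ / M * N ^ γ) ≤ 1 / (x ^ ((8 / 9 - 8 / 22) / 2 : ℝ) / 2) := by gcongr
      _ = _ := by rw [Real.rpow_neg hx0.le]; field_simp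
  have hMinv : 1 / M ≤ x ^ (-(7 / 22) : ℝ) := by
    rw [Real.rpow_neg hx0.le, one_div]
    gcongr
  have hfin : (x ^ ((1 : ℝ) - 2 * (1 / 10000))) ^ 2 = x ^ (2 - 4 / 10000 : ℝ) := by
    rw [← Real.rpow_natCast (x ^ _), ← Real.rpow_mul hx0.le]
    norm_num
  rw [hfin]
  set R : ℝ := x ^ (2 - 4 / 10000 : ℝ) with hR
  have t1 : N * Q * (L * (25 * (V * M) * N)) ≤ 25 * 2 * 12 * 16 * B * R := by
    calc N * Q * (L * (25 * (V * M) * N)) = 25 * Q * V * (M * N) ^ 2 * L * (1 / M) := by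
          field_simp
      _ ≤ 25 * (2 * x ^ q) * (12 * x ^ v) * (4 * x) ^ 2 * (B * x ^ (1 / 1000 : ℝ)) *
            x ^ (-(7 / 22) : ℝ) := by gcongr
      _ = 25 * 2 * 12 * 16 * B * (x ^ q * x ^ v * x ^ (2 : ℝ) * x ^ (1 / 1000 : ℝ) *
            x ^ (-(7 / 22) : ℝ)) := by rw [Real.rpow_two]; ring
      _ ≤ _ := by
          apply mul_le_mul_of_nonneg_left _ (by positivity)
          simp only [← Real.rpow_add hx0]
          apply hexp
          rw [hq, hv]; norm_num
  have t2 : 26 * V ^ 2 * M * (M * N) * L * (C * √(V * M ^ γ / Q * N ^ γ)) ≤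
      26 * 144 * 4 * B * C * 7 * R := by
    calc 26 * V ^ 2 * M * (M * N) * L * (C * √(V * M ^ γ / Q * N ^ γ)) ≤
          26 * (12 * x ^ v) ^ 2 * x ^ ((8 : ℝ) / 22) * (4 * x) * (B * x ^ (1 / 1000 : ℝ)) *
            (C * (7 * x ^ ((1 + 1 / 10000 - q) / 2))) := by gcongr
      _ = 26 * 144 * 4 * B * C * 7 * (x ^ v * x ^ v * x ^ ((8 : ℝ) / 22) * x ^ (1 : ℝ) *
            x ^ (1 / 1000 : ℝ) * x ^ ((1 + 1 / 10000 - q) / 2)) := by rw [Real.rpow_one]; ring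
      _ ≤ _ := by
          apply mul_le_mul_of_nonneg_left _ (by positivity)
          simp only [← Real.rpow_add hx0]
          apply hexp
          rw [hq, hv]; norm_num
  have t3 : 26 * V ^ 2 * M * (M * N) * L * (C * (N / √(M ^ γ / M * N ^ γ))) ≤
      26 * 144 * 16 * B * C * 2 * R := by
    calc 26 * V ^ 2 * M * (M * N) * L * (C * (N / √(M ^ γ / M * N ^ γ))) =
          26 * V ^ 2 * (M * N) ^ 2 * L * (C * (1 / √(M ^ γ / M * N ^ γ))) := by ring
      _ ≤ 26 * (12 * x ^ v) ^ 2 * (4 * x) ^ 2 * (B * x ^ (1 / 1000 : ℝ)) *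
            (C * (2 * x ^ (-((8 / 9 - 8 / 22) / 2) : ℝ))) := by gcongr
      _ = 26 * 144 * 16 * B * C * 2 * (x ^ v * x ^ v * x ^ (2 : ℝ) *
            x ^ (1 / 1000 : ℝ) * x ^ (-((8 / 9 - 8 / 22) / 2) : ℝ)) := by
          rw [Real.rpow_two]; ring
      _ ≤ _ := by
          apply mul_le_mul_of_nonneg_left _ (by positivity)
          simp only [← Real.rpow_add hx0]
          apply hexp
          rw [hv]; norm_num
  set E₂ : ℝ := C * √(V * M ^ γ / Q * N ^ γ) with hE₂
  set E₃ : ℝ := C * (N / √(M ^ γ / M * N ^ γ)) with hE₃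
  have hE₂0 : 0 ≤ E₂ := by positivity
  have hE₃0 : 0 ≤ E₃ := by positivity
  calc _ = N * Q * (L * (25 * (V * M) * N)) +
        N * Q * (V * M + 24 * (1 / Q) * (V ^ 2 * M ^ 2)) * L * (E₂ + E₃) := by
        rw [hE₂, hE₃]; ring
    _ ≤ N * Q * (L * (25 * (V * M) * N)) +
        26 * V ^ 2 * M * (M * N) * L * (E₂ + E₃) := by gcongr
    _ ≤ _ := by linarith

lemma mem_dyZ {Y : ℝ} {h : ℤ} : h ∈ dyZ Y ↔ h ≠ 0 ∧ Y / 2 ≤ |(h : ℝ)| ∧ |(h : ℝ)| < Y := by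
  unfold dyZ
  rw [mem_filter, mem_Icc, and_iff_right_iff_imp]
  rintro ⟨_, _, h2⟩
  have h3 : |(h : ℝ)| ≤ (⌈Y⌉₊ : ℝ) := h2.le.trans (Nat.le_ceil Y)
  have h4 : |h| ≤ (⌈Y⌉₊ : ℤ) := by exact_mod_cast h3
  exact abs_le.1 h4

lemma natCast_mem_dyZ {Y : ℝ} (hY : 1 ≤ Y) {h : ℕ} (hh : h ∈ dyN Y) : (h : ℤ) ∈ dyZ Y := by
  have h1 := one_le_of_mem_dyN hY hh
  rw [mem_dyZ, Int.cast_natCast, Nat.abs_cast]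
  exact ⟨by omega, mem_dyN.1 hh⟩

lemma neg_natCast_mem_dyZ {Y : ℝ} (hY : 1 ≤ Y) {h : ℕ} (hh : h ∈ dyN Y) : -(h : ℤ) ∈ dyZ Y := by
  have h1 := natCast_mem_dyZ hY hh
  rw [mem_dyZ] at h1 ⊢
  simpa using h1

lemma sum_dyZ {Y : ℝ} (hY : 1 ≤ Y) (f : ℤ → ℂ) :
    ∑ h ∈ dyZ Y, f h = ∑ h ∈ dyN Y, f h + ∑ h ∈ dyN Y, f (-h) := by
  have habs : ∀ h ∈ dyZ Y, h.natAbs ∈ dyN Y := by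
    intro h hh
    rw [mem_dyN, Nat.cast_natAbs, Int.cast_abs]
    exact (mem_dyZ.1 hh).2
  rw [← sum_filter_add_sum_filter_not (dyZ Y) (fun h => 0 < h)]
  congr 1
  · refine sum_nbij' Int.natAbs (fun h : ℕ => (h : ℤ)) ?_ ?_ ?_ ?_ ?_
    · intro h hh
      exact habs h (mem_filter.1 hh).1
    · intro h hh
      have := one_le_of_mem_dyN hY hh
      exact mem_filter.2 ⟨natCast_mem_dyZ hY hh, by omega⟩
    · intro h hh
      have := (mem_filter.1 hh).2
      omega
    · intro h _
      simp
    · intro h hh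
      have := (mem_filter.1 hh).2
      rw [Int.natAbs_of_nonneg this.le]
  · refine sum_nbij' Int.natAbs (fun h : ℕ => -(h : ℤ)) ?_ ?_ ?_ ?_ ?_
    · intro h hh
      exact habs h (mem_filter.1 hh).1
    · intro h hh
      have := one_le_of_mem_dyN hY hh
      exact mem_filter.2 ⟨neg_natCast_mem_dyZ hY hh, by omega⟩
    · intro h hh
      have := (mem_filter.1 hh).2
      omega
    · intro h _
      simp
    · intro h hh
      have := (mem_filter.1 hh).2
      congr 1
      omega

theorem T2_bound (c γ : ℝ) (hc1 : 1 < c) (hc2 : c < 9/8) (hγ : γ = 1/c) :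
    ∃ η > (0:ℝ), ∃ C > (0:ℝ), ∃ X₀ > (0:ℝ), ∀ X : ℕ, X₀ ≤ (X:ℝ) →
    ∀ M N V : ℝ, 1 ≤ M → 1 ≤ N → 1 ≤ V →
    (X:ℝ)^((7:ℝ)/22) ≤ M → M ≤ (X:ℝ)^((8:ℝ)/22) →
    (X:ℝ)/(2*M) ≤ N → N ≤ 4*(X:ℝ)/M → V ≤ (⌊10 * (X:ℝ)^(1-γ+η) / γ⌋₊ : ℝ) →
    ∀ am bn : ℕ → ℂ, ∀ dh : ℤ → ℂ,
    (∀ m ∈ dyN M, ‖am m‖ ≤ 1) → (∀ n ∈ dyN N, ‖bn n‖ ≤ 1) → (∀ h ∈ dyZ V, ‖dh h‖ ≤ 1) →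
    ‖∑ m ∈ dyN M, ∑ n ∈ (dyN N).filter (fun n => (X:ℝ)/2 ≤ ((m*n:ℕ):ℝ) ∧ ((m*n:ℕ):ℝ) < (X:ℝ)),
        ∑ h ∈ dyZ V, am m * bn n * dh h * e ((h:ℝ) * ((m:ℝ)*(n:ℝ))^γ)‖ ≤ C * (X:ℝ)^(1-2*η) := by

  have hc0 : 0 < c := by linarith
  have hγ0 : 8 / 9 < γ := by
    rw [hγ, lt_div_iff₀ hc0]; linarith
  have hγ1 : γ < 1 := by
    rw [hγ, div_lt_one hc0]; exact hc1
  obtain ⟨C, hC, hbil⟩ := bilinear_norm_sq_le hγ0 hγ1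
  obtain ⟨K, hK, hnum⟩ := bilinear_bound_numeric hγ0 hγ1 hC
  refine ⟨1 / 10000, by norm_num, 2 * √K, by positivity, 1, one_pos, ?_⟩
  intro X hX M N V hM hN hV hM1 hM2 hN1 hN2 hVX am bn dh ha hb hd
  have hX0 : (0 : ℝ) < X := by linarith
  set y : ℝ := (X : ℝ) ^ ((1 : ℝ) - 2 * (1 / 10000)) with hy
  have hy0 : 0 ≤ y := by positivity
  have hVX' : V ≤ 12 * (X : ℝ) ^ (1 - γ + 1 / 10000) := by
    refine hVX.trans ((Nat.floor_le (by positivity)).trans ?_)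
    rw [div_le_iff₀ (by linarith)]
    have : 0 < (X : ℝ) ^ (1 - γ + 1 / 10000) := by positivity
    nlinarith
  obtain ⟨Q, hQ, hbound⟩ := hnum X M N V hX hM hN hV hM1 hM2 hN1 hN2 hVX'
  have hpos : ∀ a b d : ℕ → ℂ, (∀ m ∈ dyN M, ‖a m‖ ≤ 1) → (∀ n ∈ dyN N, ‖b n‖ ≤ 1) →
      (∀ h ∈ dyN V, ‖d h‖ ≤ 1) →
      ‖∑ m ∈ dyN M, ∑ n ∈ (dyN N).filter
          (fun n => (X : ℝ) / 2 ≤ ((m * n : ℕ) : ℝ) ∧ ((m * n : ℕ) : ℝ) < (X : ℝ)),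
        ∑ h ∈ dyN V, a m * b n * d h * e ((h : ℝ) * ((m : ℝ) * (n : ℝ)) ^ γ)‖ ≤ √K * y := by
    intro a b d ha hb hd
    have h := (hbil X M N V hM hN hV Q hQ a b d ha hb hd).trans hbound
    have h2 := Real.le_sqrt_of_sq_le h
    rwa [Real.sqrt_mul hK.le, Real.sqrt_sq hy0] at h2
  have hplus := hpos am bn (fun h => dh h) ha hb (fun h hh => hd _ (natCast_mem_dyZ hV hh))
  have hminus := hpos (fun m => (starRingEnd ℂ) (am m)) (fun n => (starRingEnd ℂ) (bn n))
    (fun h => (starRingEnd ℂ) (dh (-h)))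
    (fun m hm => by rw [Complex.norm_conj]; exact ha m hm)
    (fun n hn => by rw [Complex.norm_conj]; exact hb n hn)
    (fun h hh => by rw [Complex.norm_conj]; exact hd _ (neg_natCast_mem_dyZ hV hh))
  rw [← Complex.norm_conj] at hminus
  simp only [map_sum, map_mul, Complex.conj_conj, conj_e, ← neg_mul] at hminus
  simp only [sum_dyZ hV, sum_add_distrib, Int.cast_natCast, Int.cast_neg]
  refine (norm_add_le _ _).trans ?_
  linarith
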